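/- Let E(A'_n) denote the average, over all reduced words i₁⋯i_ℓ for the longest element w₀ ∈ S_n chosen uniformly at random, of the number of positions k ∈ {1,…,ℓ−1} with |i_k − i_{k+1}| = 1 (consecutive noncommuting pairs). Then lim_{n→∞} n · E(A'_n)/(n(n−1)/2) = 256/(9π²). -/

import Mathlib

open scoped Classical

/-- The adjacent transposition `sᵢ ∈ S_n` swapping `i` and `i+1` (one-based),
for `i ∈ {1, …, n-1}`; junk value `1` otherwise. -/
def simpleRefl (n i : ℕ) : Equiv.Perm (Fin n) :=
  if h : 1 ≤ i ∧ i < n then Equiv.swap ⟨i - 1, by omega⟩ ⟨i, h.2⟩ else 1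

/-- The product `s_{i₁} ⋯ s_{i_m}` of the word `i₁ ⋯ i_m`. -/
def wordProd (n : ℕ) (l : List ℕ) : Equiv.Perm (Fin n) :=
  (l.map (simpleRefl n)).prod

/-- `l` is a word for `w`: letters in `{1, …, n-1}` and product `w`. -/
def IsWordFor (n : ℕ) (w : Equiv.Perm (Fin n)) (l : List ℕ) : Prop :=
  (∀ i ∈ l, 1 ≤ i ∧ i ≤ n - 1) ∧ wordProd n l = w

/-- `l` is a reduced word for `w`: a word for `w` of minimal length. -/
def IsReducedWordFor (n : ℕ) (w : Equiv.Perm (Fin n)) (l : List ℕ) : Prop :=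
  IsWordFor n w l ∧ ∀ l', IsWordFor n w l' → l.length ≤ l'.length

/-- The longest element `w₀ ∈ S_n`, `w₀(i) = n + 1 - i` in one-line notation. -/
def w₀ (n : ℕ) : Equiv.Perm (Fin n) := Fin.revPerm

/-- The number of positions of the word `l` supporting a commutation,
i.e. positions `k` with `|i_k - i_{k+1}| > 1`. -/
def commCount (l : List ℕ) : ℕ :=
  ((Finset.range (l.length - 1)).filter
    (fun k => 1 < |(l.getD k 0 : ℤ) - (l.getD (k+1) 0 : ℤ)|)).card

/-- The number of consecutive noncommuting pairs in the word `l`,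
i.e. positions `k` with `|i_k - i_{k+1}| = 1`. -/
def noncommCount (l : List ℕ) : ℕ :=
  ((Finset.range (l.length - 1)).filter
    (fun k => |(l.getD k 0 : ℤ) - (l.getD (k+1) 0 : ℤ)| = 1)).card

/-- The number of positions of `l` supporting a long braid move, i.e. positions `k`
with `(i_k, i_{k+1}, i_{k+2})` of the form `(i, i+1, i)` or `(i+1, i, i+1)`. -/
noncomputable def braidCount (l : List ℕ) : ℕ :=
  ((Finset.range (l.length - 2)).filter
    (fun k => ∃ i : ℕ,
      (l.getD k 0, l.getD (k+1) 0, l.getD (k+2) 0) = (i, i+1, i) ∨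
      (l.getD k 0, l.getD (k+1) 0, l.getD (k+2) 0) = (i+1, i, i+1))).card

/-- The average of the statistic `f` over all reduced words for `w₀ ∈ S_n`. -/
noncomputable def expectedStat (n : ℕ) (f : List ℕ → ℕ) : ℝ :=
  (∑ᶠ l ∈ {l : List ℕ | IsReducedWordFor n (w₀ n) l}, (f l : ℝ)) /
    (Nat.card {l : List ℕ // IsReducedWordFor n (w₀ n) l} : ℝ)

/-- The number of words `i₁ ⋯ i_m` with letters in `[lo, hi)` such that `s_{i₁} ⋯ s_{i_m} = w` and
each letter is a descent of the remaining product, where `sᵢ` swaps the integers `i` and `i + 1`. -/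
noncomputable def redCount (lo hi : ℤ) : ℕ → Equiv.Perm ℤ → ℤ
  | 0, w => if w = 1 then 1 else 0
  | m + 1, w => ∑ i ∈ Finset.Ico lo hi,
      if w.symm (i + 1) < w.symm i then redCount lo hi m (Equiv.swap i (i + 1) * w) else 0

/-- `w` moves only integers strictly between `lo` and `hi`. -/
def FixesOutside (lo hi : ℤ) (w : Equiv.Perm ℤ) : Prop :=
  ∀ x, x ≤ lo ∨ hi ≤ x → w x = x

/-- Exchanging the values of `w` at the positions `p < q` is a covering in Bruhat order. -/
def IsCover (w : Equiv.Perm ℤ) (p q : ℤ) : Prop :=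
  p < q ∧ w p < w q ∧ ∀ x, p < x → x < q → ¬(w p < w x ∧ w x < w q)

theorem isCover_and_descent_iff (w : Equiv.Perm ℤ) {p q i : ℤ} (hpq : p < q)
    (h₁ : ¬(w p = i ∧ w q = i + 1)) (h₂ : ¬(w p = i + 1 ∧ w q = i)) :
    (IsCover w p q ∧ (w * Equiv.swap p q).symm (i + 1) < (w * Equiv.swap p q).symm i) ↔
      (w.symm (i + 1) < w.symm i ∧ IsCover (Equiv.swap i (i + 1) * w) p q) := by
  obtain ⟨P, rfl⟩ : ∃ P, w P = i := ⟨w.symm i, by simp⟩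
  obtain ⟨Q, hQ⟩ : ∃ Q, w Q = w P + 1 := ⟨w.symm (w P + 1), by simp⟩
  have hPQ : P ≠ Q := by rintro rfl; omega
  have hval : ∀ x, (Equiv.swap (w P) (w P + 1) * w) x
      = if x = P then w P + 1 else if x = Q then w P else w x := by
    intro x
    rw [← hQ, Equiv.Perm.mul_apply, Equiv.swap_apply_def]
    simp only [w.injective.eq_iff]
  have hne : ∀ x, x ≠ P → x ≠ Q → w x < w P ∨ w P + 1 < w x := by
    intro x h1 h2
    have h3 : w x ≠ w P := fun h => h1 (w.injective h)
    have h4 : w x ≠ w Q := fun h => h2 (w.injective h)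
    omega
  have hpqv : w p ≠ w q := fun h => hpq.ne (w.injective h)
  have hinv : ∀ x, (w * Equiv.swap p q).symm (w x)
      = if x = p then q else if x = q then p else x := by
    intro x
    rw [Equiv.symm_apply_eq, Equiv.Perm.mul_apply, ← Equiv.swap_apply_def, Equiv.swap_apply_self]
  simp only [IsCover, ← hQ, hinv, Equiv.symm_apply_apply]
  have e1 : ∀ x y, w x = w y ↔ x = y := fun x y => w.injective.eq_iff
  rw [← hQ] at h₁ h₂
  simp only [e1] at h₁ h₂
  by_cases a1 : p = P <;> by_cases a2 : p = Q <;> by_cases a3 : q = P <;> by_cases a4 : q = Q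
  all_goals (try grind)

theorem redCount_transposition_term (lo hi : ℤ) (m : ℕ) (w : Equiv.Perm ℤ) {p q : ℤ} (hpq : p < q)
    (i : ℤ) :
    ((if IsCover w p q then
        if (w * Equiv.swap p q).symm (i + 1) < (w * Equiv.swap p q).symm i then
          redCount lo hi m (Equiv.swap i (i + 1) * (w * Equiv.swap p q)) else 0 else 0) -
      if w.symm (i + 1) < w.symm i then
        if IsCover (Equiv.swap i (i + 1) * w) p q then
          redCount lo hi m (Equiv.swap i (i + 1) * w * Equiv.swap p q) else 0 else 0) =
      ((if w p = i ∧ w q = i + 1 then 1 else 0) - if w p = i + 1 ∧ w q = i then 1 else 0) *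
        redCount lo hi m w := by
  have hswap : ∀ x y, Equiv.swap (w x) (w y) * (w * Equiv.swap x y) = w := by
    intro x y
    rw [← mul_assoc, Equiv.swap_mul_eq_mul_swap, Equiv.Perm.coe_inv, Equiv.symm_apply_apply,
      Equiv.symm_apply_apply, mul_assoc, Equiv.swap_mul_self, mul_one]
  by_cases h₁ : w p = i ∧ w q = i + 1
  · obtain ⟨rfl, hq⟩ := h₁
    have hc : IsCover w p q := ⟨hpq, by omega, fun x _ _ => by omega⟩
    have hd : ¬ w.symm (w p + 1) < w.symm (w p) := by
      rw [← hq, Equiv.symm_apply_apply, Equiv.symm_apply_apply]; omega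
    have hd' : (w * Equiv.swap p q).symm (w p + 1) < (w * Equiv.swap p q).symm (w p) := by
      have e1 : (w * Equiv.swap p q).symm (w p + 1) = p := by
        rw [Equiv.symm_apply_eq, Equiv.Perm.mul_apply, Equiv.swap_apply_left, hq]
      have e2 : (w * Equiv.swap p q).symm (w p) = q := by
        rw [Equiv.symm_apply_eq, Equiv.Perm.mul_apply, Equiv.swap_apply_right]
      rwa [e1, e2]
    rw [if_pos hc, if_pos hd', if_neg hd, if_pos ⟨rfl, hq⟩, if_neg (by omega), ← hq, hswap]
    ring
  by_cases h₂ : w p = i + 1 ∧ w q = i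
  · obtain ⟨hp, rfl⟩ := h₂
    have hc : ¬ IsCover w p q := fun h => by have := h.2.1; omega
    have hd : w.symm (w q + 1) < w.symm (w q) := by
      rwa [← hp, Equiv.symm_apply_apply, Equiv.symm_apply_apply]
    have hc' : IsCover (Equiv.swap (w q) (w q + 1) * w) p q := by
      refine ⟨hpq, ?_, fun x _ _ => ?_⟩ <;>
      simp only [Equiv.Perm.mul_apply, hp, Equiv.swap_apply_left, Equiv.swap_apply_right] <;> omega
    rw [if_neg hc, if_pos hd, if_pos hc', if_neg (by omega), if_pos ⟨hp, rfl⟩, mul_assoc, ← hp,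
      Equiv.swap_comm, hswap]
    ring
  · have := isCover_and_descent_iff w hpq h₁ h₂
    rw [if_neg h₁, if_neg h₂, ← ite_and, ← ite_and, if_congr this rfl rfl, mul_assoc]
    ring

theorem FixesOutside.mem_Ioo {lo hi : ℤ} {w : Equiv.Perm ℤ} (h : FixesOutside lo hi w) {x : ℤ}
    (hx : x ∈ Set.Ioo lo hi) : w x ∈ Set.Ioo lo hi := by
  by_contra hn
  have h1 : w x ≤ lo ∨ hi ≤ w x := by
    simp only [Set.mem_Ioo, not_and_or, not_lt] at hn; exact hn
  have h2 := w.injective (h _ h1)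
  rw [h2] at hn
  exact hn hx

theorem FixesOutside.symm {lo hi : ℤ} {w : Equiv.Perm ℤ} (h : FixesOutside lo hi w) :
    FixesOutside lo hi w.symm := by
  intro x hx
  rw [Equiv.symm_apply_eq, h x hx]

theorem FixesOutside.mul {lo hi : ℤ} {v w : Equiv.Perm ℤ} (hv : FixesOutside lo hi v)
    (hw : FixesOutside lo hi w) : FixesOutside lo hi (v * w) := by
  intro x hx
  rw [Equiv.Perm.mul_apply, hw x hx, hv x hx]

theorem fixesOutside_swap {lo hi x y : ℤ} (hx : x ∈ Set.Ioo lo hi) (hy : y ∈ Set.Ioo lo hi) :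
    FixesOutside lo hi (Equiv.swap x y) := by
  intro z hz
  rw [Set.mem_Ioo] at hx hy
  exact Equiv.swap_apply_of_ne_of_ne (by omega) (by omega)

theorem FixesOutside.swap_mul_of_descent {lo hi i : ℤ} {w : Equiv.Perm ℤ}
    (h : FixesOutside lo hi w) (hi' : w.symm (i + 1) < w.symm i) :
    FixesOutside lo hi (Equiv.swap i (i + 1) * w) := by
  refine FixesOutside.mul ?_ h
  by_cases h1 : lo < i
  · by_cases h2 : i + 1 < hi
    · exact fixesOutside_swap ⟨h1, by omega⟩ ⟨by omega, h2⟩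
    · exfalso
      have e := h.symm (i + 1) (Or.inr (by omega))
      by_cases h3 : i < hi
      · have := (h.symm.mem_Ioo ⟨h1, h3⟩).2
        omega
      · have := h.symm i (Or.inr (by omega)); omega
  · exfalso
    have e := h.symm i (Or.inl (by omega))
    by_cases h3 : lo < i + 1
    · by_cases h4 : i + 1 < hi
      · have := (h.symm.mem_Ioo ⟨h3, h4⟩).1
        omega
      · have := h.symm (i + 1) (Or.inr (by omega)); omega
    · have := h.symm (i + 1) (Or.inl (by omega)); omega

theorem redCount_transposition (lo hi : ℤ) (m : ℕ) (w : Equiv.Perm ℤ) {p q : ℤ} (hpq : p < q) :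
    (if IsCover w p q then redCount lo hi (m + 1) (w * Equiv.swap p q) else 0) =
      (∑ i ∈ Finset.Ico lo hi, if w.symm (i + 1) < w.symm i then
        if IsCover (Equiv.swap i (i + 1) * w) p q then
          redCount lo hi m (Equiv.swap i (i + 1) * w * Equiv.swap p q) else 0 else 0) +
      (∑ i ∈ Finset.Ico lo hi,
        ((if w p = i ∧ w q = i + 1 then 1 else 0) - if w p = i + 1 ∧ w q = i then 1 else 0)) *
          redCount lo hi m w := by
  have h : (if IsCover w p q then redCount lo hi (m + 1) (w * Equiv.swap p q) else 0) =
      ∑ i ∈ Finset.Ico lo hi, if IsCover w p q then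
        if (w * Equiv.swap p q).symm (i + 1) < (w * Equiv.swap p q).symm i then
          redCount lo hi m (Equiv.swap i (i + 1) * (w * Equiv.swap p q)) else 0 else 0 := by
    split_ifs
    · rw [redCount]
    · simp
  rw [h, Finset.sum_mul, ← Finset.sum_add_distrib]
  refine Finset.sum_congr rfl fun i _ => ?_
  rw [← redCount_transposition_term lo hi m w hpq i]
  ring

theorem FixesOutside.mem_Ico {lo hi : ℤ} {w : Equiv.Perm ℤ} (h : FixesOutside lo hi w) {x : ℤ}
    (hx : x ∈ Set.Ico lo hi) : w x ∈ Set.Ico lo hi := by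
  rcases eq_or_lt_of_le hx.1 with rfl | h1
  · rw [h _ (Or.inl le_rfl)]; exact hx
  · exact Set.Ioo_subset_Ico_self (h.mem_Ioo ⟨h1, hx.2⟩)

theorem FixesOutside.mem_Ioc {lo hi : ℤ} {w : Equiv.Perm ℤ} (h : FixesOutside lo hi w) {x : ℤ}
    (hx : x ∈ Set.Ioc lo hi) : w x ∈ Set.Ioc lo hi := by
  rcases eq_or_lt_of_le hx.2 with rfl | h1
  · rw [h _ (Or.inr le_rfl)]; exact hx
  · exact Set.Ioo_subset_Ioc_self (h.mem_Ioo ⟨hx.1, h1⟩)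

theorem sum_adjacent_values_left {lo hi r : ℤ} {w : Equiv.Perm ℤ} (hw : FixesOutside lo hi w)
    (hr : r ∈ Set.Ioo lo hi) :
    (∑ k ∈ Finset.Ico lo r, ∑ i ∈ Finset.Ico lo hi,
      ((if w k = i ∧ w r = i + 1 then (1 : ℤ) else 0) - if w k = i + 1 ∧ w r = i then 1 else 0)) =
      (if w.symm (w r - 1) < r then 1 else 0) - if w.symm (w r + 1) < r then 1 else 0 := by
  have ha := hw.mem_Ioo hr
  have hb := hw.symm.mem_Ico (x := w r - 1) ⟨by have := ha.1; omega, by have := ha.2; omega⟩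
  have hc := hw.symm.mem_Ioc (x := w r + 1) ⟨by have := ha.1; omega, by have := ha.2; omega⟩
  have inner : ∀ k ∈ Finset.Ico lo r, ∑ i ∈ Finset.Ico lo hi,
      ((if w k = i ∧ w r = i + 1 then (1 : ℤ) else 0) - if w k = i + 1 ∧ w r = i then 1 else 0) =
      (if w.symm (w r - 1) = k then 1 else 0) - if w.symm (w r + 1) = k then 1 else 0 := by
    intro k hk
    have h1 : ∀ i, (w k = i ∧ w r = i + 1) ↔ (w r - 1 = i ∧ w.symm (w r - 1) = k) := by
      intro i; rw [Equiv.symm_apply_eq]; omega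
    have h2 : ∀ i, (w k = i + 1 ∧ w r = i) ↔ (w r = i ∧ w.symm (w r + 1) = k) := by
      intro i; rw [Equiv.symm_apply_eq]; omega
    simp only [h1, h2, ite_and, Finset.sum_sub_distrib, Finset.sum_ite_eq]
    have m1 : w r ∈ Finset.Ico lo hi := Finset.mem_Ico.2 ⟨ha.1.le, ha.2⟩
    have m2 : w r - 1 ∈ Finset.Ico lo hi := by
      have := ha.1; have := ha.2; exact Finset.mem_Ico.2 ⟨by omega, by omega⟩
    rw [if_pos m1, if_pos m2]
  rw [Finset.sum_congr rfl inner, Finset.sum_sub_distrib, Finset.sum_ite_eq, Finset.sum_ite_eq]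
  simp only [Finset.mem_Ico, hb.1, hc.1.le, true_and]

theorem sum_adjacent_values_right {lo hi r : ℤ} {w : Equiv.Perm ℤ} (hw : FixesOutside lo hi w)
    (hr : r ∈ Set.Ioo lo hi) :
    (∑ s ∈ Finset.Ioc r hi, ∑ i ∈ Finset.Ico lo hi,
      ((if w r = i ∧ w s = i + 1 then (1 : ℤ) else 0) - if w r = i + 1 ∧ w s = i then 1 else 0)) =
      (if r < w.symm (w r + 1) then 1 else 0) - if r < w.symm (w r - 1) then 1 else 0 := by
  have ha := hw.mem_Ioo hr
  have hb := hw.symm.mem_Ico (x := w r - 1) ⟨by have := ha.1; omega, by have := ha.2; omega⟩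
  have hc := hw.symm.mem_Ioc (x := w r + 1) ⟨by have := ha.1; omega, by have := ha.2; omega⟩
  have inner : ∀ s ∈ Finset.Ioc r hi, ∑ i ∈ Finset.Ico lo hi,
      ((if w r = i ∧ w s = i + 1 then (1 : ℤ) else 0) - if w r = i + 1 ∧ w s = i then 1 else 0) =
      (if w.symm (w r + 1) = s then 1 else 0) - if w.symm (w r - 1) = s then 1 else 0 := by
    intro s hs
    have h1 : ∀ i, (w r = i ∧ w s = i + 1) ↔ (w r = i ∧ w.symm (w r + 1) = s) := by
      intro i; rw [Equiv.symm_apply_eq]; omega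
    have h2 : ∀ i, (w r = i + 1 ∧ w s = i) ↔ (w r - 1 = i ∧ w.symm (w r - 1) = s) := by
      intro i; rw [Equiv.symm_apply_eq]; omega
    simp only [h1, h2, ite_and, Finset.sum_sub_distrib, Finset.sum_ite_eq]
    have m1 : w r ∈ Finset.Ico lo hi := Finset.mem_Ico.2 ⟨ha.1.le, ha.2⟩
    have m2 : w r - 1 ∈ Finset.Ico lo hi := by
      have := ha.1; have := ha.2; exact Finset.mem_Ico.2 ⟨by omega, by omega⟩
    rw [if_pos m1, if_pos m2]
  rw [Finset.sum_congr rfl inner, Finset.sum_sub_distrib, Finset.sum_ite_eq, Finset.sum_ite_eq]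
  simp only [Finset.mem_Ioc, hb.2.le, hc.2, and_true]

/-- The transition identity for numbers of reduced words. -/
theorem redCount_transition (lo hi : ℤ) {r : ℤ} (hr : r ∈ Set.Ioo lo hi) (m : ℕ) :
    ∀ w : Equiv.Perm ℤ, FixesOutside lo hi w →
      (∑ k ∈ Finset.Ico lo r, if IsCover w k r then redCount lo hi m (w * Equiv.swap k r) else 0) =
        ∑ s ∈ Finset.Ioc r hi, if IsCover w r s then redCount lo hi m (w * Equiv.swap r s) else 0 := by
  induction m with
  | zero =>
    have key : ∀ (w : Equiv.Perm ℤ) (p q : ℤ),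
        (if IsCover w p q then redCount lo hi 0 (w * Equiv.swap p q) else 0) = 0 := by
      intro w p q
      split_ifs with h
      · rw [redCount, if_neg]
        intro h1
        have e1 : w q = p := by simpa using DFunLike.congr_fun h1 p
        have e2 : w p = q := by simpa using DFunLike.congr_fun h1 q
        have := h.1; have := h.2.1
        omega
      · rfl
    intro w _
    simp only [key, Finset.sum_const_zero]
  | succ m ih =>
    intro w hw
    rw [Finset.sum_congr rfl fun k hk =>
        redCount_transposition lo hi m w (Finset.mem_Ico.1 hk).2,
      Finset.sum_congr rfl fun s hs =>
        redCount_transposition lo hi m w (Finset.mem_Ioc.1 hs).1,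
      Finset.sum_add_distrib, Finset.sum_add_distrib, ← Finset.sum_mul, ← Finset.sum_mul,
      sum_adjacent_values_left hw hr, sum_adjacent_values_right hw hr, Finset.sum_comm,
      Finset.sum_comm (s := Finset.Ioc r hi)]
    congr 1
    · refine Finset.sum_congr rfl fun i _ => ?_
      split_ifs with hd
      · exact ih _ (hw.swap_mul_of_descent hd)
      · simp
    · have h1 : w.symm (w r + 1) ≠ r := by rw [ne_eq, Equiv.symm_apply_eq]; omega
      have h2 : w.symm (w r - 1) ≠ r := by rw [ne_eq, Equiv.symm_apply_eq]; omega
      congr 1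
      split_ifs <;> omega

/-- One-line notation of `u`: increasing values forming the set `A` at the negative positions,
the values `β` at the positions in `[0, r)`, the value `x` at `r`, increasing values after `r`. -/
structure InsertionState (lo hi : ℤ) (u : Equiv.Perm ℤ) (A : Set ℤ) (β : ℤ → ℤ) (r x : ℤ) :
    Prop where
  fixes : FixesOutside lo hi u
  lo_neg : lo < 0
  nonneg : 0 ≤ r
  lt_hi : r < hi
  mono_left : ∀ i j, i < j → j < 0 → u i < u j
  mem_iff : ∀ j, u j ∈ A ↔ j < 0
  middle : ∀ j, 0 ≤ j → j < r → u j = β j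
  apply_eq : u r = x
  mono_right : ∀ i j, r < i → i < j → u i < u j

set_option maxHeartbeats 1000000 in
theorem InsertionState.step {lo hi : ℤ} {u : Equiv.Perm ℤ} {A : Set ℤ} {β : ℤ → ℤ} {r x : ℤ}
    (h : InsertionState lo hi u A β r x) {y z : ℤ} (hz : z ∈ A) (hlo : lo < z) (hzy : z < y)
    (hyx : y < x) (hy : y ∉ A) (hβ : ∀ j, 0 ≤ j → j < r → y < β j)
    (h₁ : ∀ v, z < v → v < y → v ∉ A)
    (h₂ : ∀ v, y < v → v < x → v ∈ A ∨ ∃ j, 0 ≤ j ∧ j < r ∧ β j = v) :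
    ∃ u', InsertionState lo hi u' {v | v ≠ z ∧ (v ∈ A ∨ v = y)} β r z ∧
      ∀ m, redCount lo hi m u' = redCount lo hi m u := by
  obtain ⟨s, rfl⟩ : ∃ s, u s = y := ⟨u.symm y, by simp⟩
  obtain ⟨k, rfl⟩ : ∃ k, u k = z := ⟨u.symm z, by simp⟩
  obtain ⟨hfix, hlo0, hr0, hrhi, hml, hmem, hmid, rfl, hmr⟩ := h
  have hk : k < 0 := (hmem k).1 hz
  have hs0 : 0 ≤ s := by
    by_contra hn; exact hy ((hmem s).2 (by omega))
  have hsr : r < s := by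
    rcases lt_trichotomy s r with h | h | h
    · have := hβ s hs0 h; rw [hmid s hs0 h] at this; omega
    · subst h; omega
    · exact h
  have hshi : s < hi := by
    by_contra hn
    have e := hfix s (Or.inr (by omega))
    have e2 := u.injective (hfix (u r) (Or.inr (by omega)))
    omega
  have hklo : lo < k := by
    by_contra hn
    have e := hfix k (Or.inl (by omega))
    omega
  have inj : ∀ i j, u i = u j → i = j := fun i j e => u.injective e
  set w := u * Equiv.swap r s with hw
  have wval : ∀ j, w j = if j = r then u s else if j = s then u r else u j := by
    intro j
    rw [hw, Equiv.Perm.mul_apply, Equiv.swap_apply_def]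
    split_ifs <;> rfl
  have hr' : r ∈ Set.Ioo lo hi := ⟨by omega, hrhi⟩
  have hs' : s ∈ Set.Ioo lo hi := ⟨by omega, hshi⟩
  have hk' : k ∈ Set.Ioo lo hi := ⟨hklo, by omega⟩
  have hwfix : FixesOutside lo hi w := hfix.mul (fixesOutside_swap hr' hs')
  have hmid' : ∀ j, 0 ≤ j → j < r → u s < u j := fun j h1 h2 => by
    rw [hmid j h1 h2]; exact hβ j h1 h2
  have hnot : ∀ j, r < j → ¬ (u s < u j ∧ u j < u r) := by
    rintro j hj ⟨h3, h4⟩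
    rcases h₂ _ h3 h4 with h5 | ⟨i, hi1, hi2, hi3⟩
    · have := (hmem j).1 h5; omega
    · rw [← hmid i hi1 hi2] at hi3
      have := inj _ _ hi3; omega
  have hnot' : ∀ j, j < 0 → ¬ (u k < u j ∧ u j ≤ u s) := by
    rintro j hj ⟨h3, h4⟩
    rcases h4.lt_or_eq with h5 | h5
    · exact h₁ _ h3 h5 ((hmem j).2 hj)
    · have := inj _ _ h5; omega
  have hright : ∀ q, IsCover w r q ↔ q = s := by
    intro q
    simp only [IsCover, wval]
    constructor
    · rintro ⟨h1, h2, h3⟩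
      by_contra hq
      have h4 := hnot q h1
      have h5 := h3 s hsr
      have h6 := fun hqs : q < s => hmr q s h1 hqs
      have h7 := inj q r
      grind
    · rintro rfl
      refine ⟨hsr, ?_, ?_⟩
      · grind
      · intro p h1 h2
        have := hmr p q h1 h2
        grind
  have hleft : ∀ q, q < r → (IsCover w q r ↔ q = k) := by
    intro q hq
    simp only [IsCover, wval]
    constructor
    · rintro ⟨h1, h2, h3⟩
      by_contra hqk
      have h4 := hmid' q
      have h5 := hnot' q
      have h6 := h3 k
      have h7 := inj q k
      have h8 : q < k → u q < u k := fun h => hml q k h hk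
      have h9 : k < q → q < 0 → u k < u q := fun h h' => hml k q h h'
      grind
    · rintro rfl
      refine ⟨hq, ?_, ?_⟩
      · grind
      · intro p h1 h2
        have := hnot' p
        have := hmid' p
        grind
  set u' := w * Equiv.swap k r with hu'
  have uval : ∀ j, u' j = if j = k then u s else if j = r then u k else if j = s then u r
      else u j := by
    intro j
    rw [hu', Equiv.Perm.mul_apply]
    rcases eq_or_ne j k with rfl | h1
    · rw [Equiv.swap_apply_left, wval, if_pos rfl, if_pos rfl]
    rw [if_neg h1]
    rcases eq_or_ne j r with rfl | h2
    · rw [Equiv.swap_apply_right, wval, if_neg (by omega), if_neg (by omega), if_pos rfl]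
    · rw [Equiv.swap_apply_of_ne_of_ne h1 h2, wval, if_neg h2, if_neg h2]
  refine ⟨u', ⟨hwfix.mul (fixesOutside_swap hk' hr'), hlo0, hr0, hrhi, ?_, ?_, ?_, ?_, ?_⟩, ?_⟩
  · intro i j hij hj
    have h1 := hml i j hij hj
    have h2 := hnot' j hj
    have h3 : k < j → u k < u j := fun h => hml k j h hj
    have h4 : i < k → u i < u k := fun h => hml i k h hk
    rw [uval, uval, if_neg (show i ≠ r by omega), if_neg (show i ≠ s by omega),
      if_neg (show j ≠ r by omega), if_neg (show j ≠ s by omega)]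
    split_ifs <;> omega
  · intro j
    have h1 := hmem j
    have h2 := inj j k
    have h3 := inj j s
    have h4 := inj s k
    have h5 := hmem r
    have h6 := inj r k
    rw [uval, Set.mem_ofPred_eq]
    split_ifs with e1 e2 e3
    · subst e1
      exact ⟨fun _ => hk, fun _ => ⟨by omega, Or.inr rfl⟩⟩
    · subst e2
      exact ⟨fun h => absurd rfl h.1, fun h => absurd h (by omega)⟩
    · subst e3
      refine ⟨fun h => ?_, fun h => absurd h (by omega)⟩
      rcases h.2 with h | h
      · exact absurd (h5.1 h) (by omega)
      · omega
    · refine ⟨fun h => ?_, fun h => ⟨fun h' => e1 (h2 h'), Or.inl (h1.2 h)⟩⟩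
      rcases h.2 with h | h
      · exact h1.1 h
      · exact absurd (h3 h) e3
  · intro j h1 h2
    rw [uval, if_neg (by omega), if_neg (by omega), if_neg (by omega), hmid j h1 h2]
  · rw [uval, if_neg (by omega), if_pos rfl]
  · intro i j hi' hij
    have h1 := hmr i j hi' hij
    have h2 : i < s → u i < u s := fun h => hmr i s hi' h
    have h3 : s < j → u s < u j := fun h => hmr s j hsr h
    have h4 := hnot j
    rw [uval, uval, if_neg (show i ≠ k by omega), if_neg (show i ≠ r by omega),
      if_neg (show j ≠ k by omega), if_neg (show j ≠ r by omega)]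
    have h5 := inj j r
    split_ifs <;> omega
  · intro m
    have := redCount_transition lo hi hr' m w hwfix
    rw [Finset.sum_eq_single k, Finset.sum_eq_single s, if_pos ((hleft k (by omega)).2 rfl),
      if_pos ((hright s).2 rfl)] at this
    · rw [hu', this, hw, mul_assoc, Equiv.swap_mul_self, mul_one]
    · intro q _ hq
      rw [if_neg (fun h => hq ((hright q).1 h))]
    · intro hn
      exact absurd (Finset.mem_Ioc.2 ⟨hsr, hshi.le⟩) hn
    · intro q hq1 hq
      rw [if_neg (fun h => hq ((hleft q (Finset.mem_Ico.1 hq1).2).1 h))]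
    · intro hn
      exact absurd (Finset.mem_Ico.2 ⟨hklo.le, by omega⟩) hn

/-- Some permutation in the given insertion state has the same counts `redCount` as `u₀`. -/
def ReachesInsertion (lo hi : ℤ) (u₀ : Equiv.Perm ℤ) (A : Set ℤ) (β : ℤ → ℤ) (r x : ℤ) : Prop :=
  ∃ u, InsertionState lo hi u A β r x ∧ ∀ m, redCount lo hi m u = redCount lo hi m u₀

/-- One-line notation of `u`: increasing values forming the set `A` at the negative positions,
the values `β` at the positions in `[0, r)`, increasing values from `r` on. -/
structure SettledState (lo hi : ℤ) (u : Equiv.Perm ℤ) (A : Set ℤ) (β : ℤ → ℤ) (r : ℤ) :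
    Prop where
  fixes : FixesOutside lo hi u
  lo_neg : lo < 0
  nonneg : 0 ≤ r
  lt_hi : r < hi
  mono_left : ∀ i j, i < j → j < 0 → u i < u j
  mem_iff : ∀ j, u j ∈ A ↔ j < 0
  middle : ∀ j, 0 ≤ j → j < r → u j = β j
  mono_right : ∀ i j, r ≤ i → i < j → u i < u j

/-- Some permutation in the given settled state has the same counts `redCount` as `u₀`. -/
def ReachesSettled (lo hi : ℤ) (u₀ : Equiv.Perm ℤ) (A : Set ℤ) (β : ℤ → ℤ) (r : ℤ) : Prop :=
  ∃ u, SettledState lo hi u A β r ∧ ∀ m, redCount lo hi m u = redCount lo hi m u₀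

theorem ReachesInsertion.step {lo hi : ℤ} {u₀ : Equiv.Perm ℤ} {A : Set ℤ} {β : ℤ → ℤ} {r x : ℤ}
    (h : ReachesInsertion lo hi u₀ A β r x) {y z : ℤ} (hz : z ∈ A) (hlo : lo < z) (hzy : z < y)
    (hyx : y < x) (hy : y ∉ A) (hβ : ∀ j, 0 ≤ j → j < r → y < β j)
    (h₁ : ∀ v, z < v → v < y → v ∉ A)
    (h₂ : ∀ v, y < v → v < x → v ∈ A ∨ ∃ j, 0 ≤ j ∧ j < r ∧ β j = v) :
    ReachesInsertion lo hi u₀ {v | v ≠ z ∧ (v ∈ A ∨ v = y)} β r z := by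
  obtain ⟨u, hu, hc⟩ := h
  obtain ⟨u', hu', hc'⟩ := hu.step hz hlo hzy hyx hy hβ h₁ h₂
  exact ⟨u', hu', fun m => (hc' m).trans (hc m)⟩

theorem ReachesInsertion.cascade {lo hi : ℤ} {u₀ : Equiv.Perm ℤ} {β : ℤ → ℤ} {r y : ℤ}
    (hlo : lo < y) (i : ℕ) : ∀ {A : Set ℤ} {x : ℤ}, ReachesInsertion lo hi u₀ A β r x →
    x = y + 2 * i → (∀ v, y ≤ v → v < x → (v ∈ A ↔ (x - v) % 2 = 0)) →
    (∀ j, 0 ≤ j → j < r → x ≤ β j) →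
    ReachesInsertion lo hi u₀
      {v | (v ∈ A ∧ (v < y ∨ x ≤ v)) ∨ (y ≤ v ∧ v < x ∧ (x - v) % 2 ≠ 0)} β r y := by
  induction i with
  | zero =>
    intro A x h hx halt hβ
    obtain rfl : x = y := by omega
    convert h using 1
    ext v
    have : v < x ∨ x ≤ v := lt_or_ge _ _
    simp only [Set.mem_ofPred_eq]
    constructor
    · rintro (h | h)
      · exact h.1
      · omega
    · exact fun h => Or.inl ⟨h, this⟩
  | succ i ih =>
    intro A x h hx halt hβ
    push_cast at hx
    have hs := h.step (y := x - 1) (z := x - 2) ((halt _ (by omega) (by omega)).2 (by omega))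
      (by omega) (by omega) (by omega) (by rw [halt _ (by omega) (by omega)]; omega)
      (fun j h1 h2 => by have := hβ j h1 h2; omega) (fun v h1 h2 => by omega)
      (fun v h1 h2 => by omega)
    have := ih hs (by omega) (fun v h1 h2 => by
      have := halt v h1 (by omega)
      simp only [Set.mem_ofPred_eq, this]
      omega) (fun j h1 h2 => by have := hβ j h1 h2; omega)
    convert this using 1
    ext v
    simp only [Set.mem_ofPred_eq]
    by_cases hv : y ≤ v ∧ v < x
    · rw [halt v hv.1 hv.2]
      omega
    · by_cases hv' : v ∈ A <;> simp only [hv', true_and, and_true, false_and, true_or, false_or] <;> omega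

theorem ReachesInsertion.settle {lo hi : ℤ} {u₀ : Equiv.Perm ℤ} {A : Set ℤ} {β : ℤ → ℤ}
    {r x : ℤ} (h : ReachesInsertion lo hi u₀ A β r x)
    (hmin : ∀ v, v ≤ x → v ∈ A ∨ (∃ j, 0 ≤ j ∧ j < r ∧ β j = v) ∨ v = x) :
    ReachesSettled lo hi u₀ A β r := by
  obtain ⟨u, ⟨hfix, hlo0, hr0, hrhi, hml, hmem, hmid, rfl, hmr⟩, hc⟩ := h
  refine ⟨u, ⟨hfix, hlo0, hr0, hrhi, hml, hmem, hmid, ?_⟩, hc⟩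
  intro i j hi' hij
  rcases hi'.eq_or_lt with rfl | h1
  · by_contra hn
    rcases hmin (u j) (by omega) with h | ⟨k, h2, h3, h4⟩ | h
    · have := (hmem j).1 h; omega
    · rw [← hmid k h2 h3] at h4
      have := u.injective h4; omega
    · have := u.injective h; omega
  · exact hmr i j h1 hij

theorem ReachesSettled.insert {lo hi : ℤ} {u₀ : Equiv.Perm ℤ} {A : Set ℤ} {β : ℤ → ℤ} {r x : ℤ}
    (h : ReachesSettled lo hi u₀ A β (r + 1)) (hr : 0 ≤ r) (hx : β r = x) :
    ReachesInsertion lo hi u₀ A β r x := by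
  obtain ⟨u, ⟨hfix, hlo0, hr0, hrhi, hml, hmem, hmid, hmr⟩, hc⟩ := h
  exact ⟨u, ⟨hfix, hlo0, hr, by omega, hml, hmem, fun j h1 h2 => hmid j h1 (by omega),
    (hmid r hr (by omega)).trans hx, fun i j h1 h2 => hmr i j (by omega) h2⟩, hc⟩

theorem ReachesSettled.congr {lo hi : ℤ} {u₀ : Equiv.Perm ℤ} {A B : Set ℤ} {β : ℤ → ℤ} {r : ℤ}
    (h : ReachesSettled lo hi u₀ A β r) (hAB : ∀ v, v ∈ A ↔ v ∈ B) :
    ReachesSettled lo hi u₀ B β r := by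
  rwa [← Set.ext hAB]

/-- The integers `v < -K` together with the `v ∈ [-K, K)` of the parity of `K`. -/
def alternatingSet (K : ℤ) : Set ℤ :=
  {v | v < -K ∨ (-K ≤ v ∧ v < K ∧ (v - K) % 2 = 0)}

/-- Inserting the values `0, 1, …, K - 1` in this order, all of them smaller than the values that
stay in the middle. -/
theorem ReachesSettled.insert_range {n : ℕ} {u₀ : Equiv.Perm ℤ} {β : ℤ → ℤ}
    (h : ReachesSettled (-n - 1) (n + 1) u₀ (alternatingSet 0) β n) (T : ℕ) (hT : T ≤ n)
    (hβ : ∀ j : ℤ, n - T ≤ j → j < n → β j = n - 1 - j)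
    (hβ' : ∀ j : ℤ, 0 ≤ j → j < n - T → T ≤ β j) :
    ∀ K : ℕ, K ≤ T →
      ReachesSettled (-n - 1) (n + 1) u₀ (alternatingSet K) β (n - K) := by
  intro K
  induction K with
  | zero => simpa using h
  | succ K ih =>
    intro hK
    have h1 := ih (by omega)
    have h2 : (n : ℤ) - K = (n - (K + 1 : ℕ)) + 1 := by push_cast; ring
    rw [h2] at h1
    have h3 := h1.insert (x := K) (by omega) (by rw [hβ _ (by omega) (by omega)]; push_cast; ring)
    have h4 := h3.cascade (y := -K) (by omega) K (by ring)
      (fun v _ _ => by simp only [alternatingSet, Set.mem_ofPred_eq]; omega)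
      (fun j h5 h6 => by
        by_cases h7 : (n : ℤ) - T ≤ j
        · rw [hβ j h7 (by omega)]; omega
        · have := hβ' j h5 (by omega); omega)
    refine (h4.settle ?_).congr ?_
    · intro v hv
      simp only [alternatingSet, Set.mem_ofPred_eq]
      omega
    · intro v
      simp only [alternatingSet, Set.mem_ofPred_eq]
      push_cast
      omega

theorem ReachesInsertion.congr {lo hi : ℤ} {u₀ : Equiv.Perm ℤ} {A B : Set ℤ} {β : ℤ → ℤ}
    {r x : ℤ} (h : ReachesInsertion lo hi u₀ A β r x) (hAB : ∀ v, v ∈ A ↔ v ∈ B) :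
    ReachesInsertion lo hi u₀ B β r x := by
  rwa [← Set.ext hAB]

theorem ReachesInsertion.cascade_to {lo hi : ℤ} {u₀ : Equiv.Perm ℤ} {β : ℤ → ℤ} {r x : ℤ}
    {A : Set ℤ} (h : ReachesInsertion lo hi u₀ A β r x) (y : ℤ) (hlo : lo < y) (hyx : y ≤ x)
    (hpar : (x - y) % 2 = 0) (halt : ∀ v, y ≤ v → v < x → (v ∈ A ↔ (x - v) % 2 = 0))
    (hβ : ∀ j, 0 ≤ j → j < r → x ≤ β j) :
    ReachesInsertion lo hi u₀
      {v | (v ∈ A ∧ (v < y ∨ x ≤ v)) ∨ (y ≤ v ∧ v < x ∧ (x - v) % 2 ≠ 0)} β r y :=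
  h.cascade hlo ((x - y) / 2).toNat (by omega) halt hβ

/-- The alternating set of size `K` with its elements `2t + 2 - K` and `2t + 4 - K` decreased
by one. -/
def dentedSet (t K : ℤ) : Set ℤ :=
  {v | v < -K ∨ (-K ≤ v ∧ v < K ∧ ((v < 2 * t + 1 - K ∨ 2 * t + 5 - K ≤ v) ∧ (v - K) % 2 = 0 ∨
    v = 2 * t + 1 - K ∨ v = 2 * t + 3 - K))}

theorem ReachesSettled.insert_add_two {n : ℕ} {u₀ : Equiv.Perm ℤ} {β : ℤ → ℤ} {t : ℤ} (ht : 0 ≤ t)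
    (htn : t + 3 ≤ n) (h : ReachesSettled (-n - 1) (n + 1) u₀ (alternatingSet t) β (n - t))
    (h₁ : β (n - 1 - t) = t + 2) (h₂ : β (n - 2 - t) = t) (h₃ : β (n - 3 - t) = t + 1)
    (hβ : ∀ j : ℤ, 0 ≤ j → j < n - 3 - t → β j = n - 1 - j) :
    ReachesSettled (-n - 1) (n + 1) u₀ (alternatingSet (t + 1)) β (n - 1 - t) := by
  rw [show (n : ℤ) - t = n - 1 - t + 1 by ring] at h
  have h := h.insert (by omega) h₁
  have hβ' : ∀ j : ℤ, 0 ≤ j → j < n - 1 - t → t ≤ β j := by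
    intro j h4 h5
    rcases (by omega : j = n - 2 - t ∨ j = n - 3 - t ∨ j < n - 3 - t) with rfl | rfl | h6
    · omega
    · omega
    · rw [hβ j h4 h6]; omega
  have hmem : ∀ v, t ≤ v → v ≤ t + 2 →
      (∃ j, 0 ≤ j ∧ j < n - 1 - t ∧ β j = v) ∨ v = t + 2 := by
    intro v h4 h5
    rcases (by omega : v = t ∨ v = t + 1 ∨ v = t + 2) with rfl | rfl | rfl
    · exact Or.inl ⟨_, by omega, by omega, h₂⟩
    · exact Or.inl ⟨_, by omega, by omega, h₃⟩
    · exact Or.inr rfl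
  rcases ht.eq_or_lt with rfl | ht
  · refine (h.settle fun v hv => ?_).congr fun v => ?_
    · rcases lt_or_ge v 0 with h4 | h4
      · left; simp only [alternatingSet, Set.mem_ofPred_eq]; omega
      · right; exact hmem v h4 hv
    · simp only [alternatingSet, Set.mem_ofPred_eq]; omega
  have h := h.step (y := t - 1) (z := t - 2)
    (by simp only [alternatingSet, Set.mem_ofPred_eq]; omega) (by omega) (by omega) (by omega)
    (by simp only [alternatingSet, Set.mem_ofPred_eq]; omega)
    (fun j h4 h5 => by have := hβ' j h4 h5; omega) (by omega)
    (fun v h4 h5 => by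
      rcases hmem v (by omega) h5.le with h6 | h6
      · exact Or.inr h6
      · omega)
  have h := h.cascade_to (-t) (by omega) (by omega) (by omega)
    (fun v _ _ => by simp only [alternatingSet, Set.mem_ofPred_eq]; omega)
    (fun j h4 h5 => by have := hβ' j h4 h5; omega)
  refine (h.settle fun v hv => ?_).congr fun v => ?_ <;>
  simp only [alternatingSet, Set.mem_ofPred_eq] <;> omega

theorem ReachesSettled.insert_self {n : ℕ} {u₀ : Equiv.Perm ℤ} {β : ℤ → ℤ} {t : ℤ} (ht : 0 ≤ t)
    (htn : t + 3 ≤ n)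
    (h : ReachesSettled (-n - 1) (n + 1) u₀ (alternatingSet (t + 1)) β (n - 1 - t))
    (h₂ : β (n - 2 - t) = t) (h₃ : β (n - 3 - t) = t + 1)
    (hβ : ∀ j : ℤ, 0 ≤ j → j < n - 3 - t → β j = n - 1 - j) :
    ReachesSettled (-n - 1) (n + 1) u₀
      {v | v = t - 1 ∨ (-t ≤ v ∧ v ≤ t - 2 ∧ (v - t) % 2 = 0) ∨ v < -t - 1} β (n - 2 - t) := by
  rw [show (n : ℤ) - 1 - t = n - 2 - t + 1 by ring] at h
  have h := h.insert (by omega) h₂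
  have hβ' : ∀ j : ℤ, 0 ≤ j → j < n - 2 - t → t ≤ β j := by
    intro j h4 h5
    rcases (by omega : j = n - 3 - t ∨ j < n - 3 - t) with rfl | h6
    · omega
    · rw [hβ j h4 h6]; omega
  rcases ht.eq_or_lt with rfl | ht
  · refine (h.settle fun v hv => ?_).congr fun v => ?_ <;>
    simp only [alternatingSet, Set.mem_ofPred_eq] <;> omega
  have h := h.step (y := t - 2) (z := t - 3)
    (by simp only [alternatingSet, Set.mem_ofPred_eq]; omega) (by omega) (by omega) (by omega)
    (by simp only [alternatingSet, Set.mem_ofPred_eq]; omega)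
    (fun j h4 h5 => by have := hβ' j h4 h5; omega) (by omega)
    (fun v h4 h5 => by simp only [alternatingSet, Set.mem_ofPred_eq]; omega)
  have h := h.cascade_to (-t - 1) (by omega) (by omega) (by omega)
    (fun v _ _ => by simp only [alternatingSet, Set.mem_ofPred_eq]; omega)
    (fun j h4 h5 => by have := hβ' j h4 h5; omega)
  refine (h.settle fun v hv => ?_).congr fun v => ?_ <;>
  simp only [alternatingSet, Set.mem_ofPred_eq] <;> omega

theorem ReachesSettled.insert_add_one {n : ℕ} {u₀ : Equiv.Perm ℤ} {β : ℤ → ℤ} {t : ℤ}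
    (ht : 0 ≤ t) (htn : t + 3 ≤ n)
    (h : ReachesSettled (-n - 1) (n + 1) u₀
      {v | v = t - 1 ∨ (-t ≤ v ∧ v ≤ t - 2 ∧ (v - t) % 2 = 0) ∨ v < -t - 1} β (n - 2 - t))
    (h₃ : β (n - 3 - t) = t + 1)
    (hβ : ∀ j : ℤ, 0 ≤ j → j < n - 3 - t → β j = n - 1 - j) :
    ReachesSettled (-n - 1) (n + 1) u₀ (dentedSet t (t + 3)) β (n - 3 - t) := by
  rw [show (n : ℤ) - 2 - t = n - 3 - t + 1 by ring] at h
  have h := h.insert (by omega) h₃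
  have hβ' : ∀ j : ℤ, 0 ≤ j → j < n - 3 - t → t + 2 < β j := by
    intro j h4 h5
    rw [hβ j h4 h5]; omega
  have h := h.step (y := t) (z := t - 1)
    (Or.inl rfl) (by omega) (by omega) (by omega)
    (by simp only [Set.mem_ofPred_eq]; omega)
    (fun j h4 h5 => by have := hβ' j h4 h5; omega) (by omega) (by omega)
  rcases ht.eq_or_lt with rfl | ht
  · refine (h.settle fun v hv => ?_).congr fun v => ?_ <;>
    simp only [dentedSet, Set.mem_ofPred_eq] <;> omega
  have h := h.step (y := t - 3) (z := t - 4)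
    (by simp only [Set.mem_ofPred_eq]; omega) (by omega) (by omega) (by omega)
    (by simp only [Set.mem_ofPred_eq]; omega)
    (fun j h4 h5 => by have := hβ' j h4 h5; omega) (by omega)
    (fun v h4 h5 => by simp only [Set.mem_ofPred_eq]; omega)
  have h := h.cascade_to (-t - 2) (by omega) (by omega) (by omega)
    (fun v _ _ => by simp only [Set.mem_ofPred_eq]; omega)
    (fun j h4 h5 => by have := hβ' j h4 h5; omega)
  refine (h.settle fun v hv => ?_).congr fun v => ?_ <;>
  simp only [dentedSet, Set.mem_ofPred_eq] <;> omega

theorem ReachesSettled.insert_dented {n : ℕ} {u₀ : Equiv.Perm ℤ} {β : ℤ → ℤ} {t K : ℤ}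
    (ht : 0 ≤ t) (htK : t + 3 ≤ K) (hK : K < n)
    (h : ReachesSettled (-n - 1) (n + 1) u₀ (dentedSet t K) β (n - K))
    (hβ : ∀ j : ℤ, 0 ≤ j → j < n - 3 - t → β j = n - 1 - j) :
    ReachesSettled (-n - 1) (n + 1) u₀ (dentedSet t (K + 1)) β (n - (K + 1)) := by
  rw [show (n : ℤ) - K = n - (K + 1) + 1 by ring] at h
  have h := h.insert (x := K) (by omega) (by rw [hβ _ (by omega) (by omega)]; ring)
  have hβ' : ∀ j : ℤ, 0 ≤ j → j < n - (K + 1) → K ≤ β j := by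
    intro j h4 h5
    rw [hβ j h4 (by omega)]; omega
  have h := h.cascade_to (2 * t + 6 - K) (by omega) (by omega) (by omega)
    (fun v _ _ => by simp only [dentedSet, Set.mem_ofPred_eq]; omega)
    (fun j h4 h5 => by have := hβ' j h4 h5; omega)
  have h := h.step (y := 2 * t + 5 - K) (z := 2 * t + 3 - K)
    (by simp only [dentedSet, Set.mem_ofPred_eq, or_true, and_true]; omega)
    (by omega) (by omega) (by omega)
    (by simp only [dentedSet, Set.mem_ofPred_eq]; omega)
    (fun j h4 h5 => by have := hβ' j h4 h5; omega)
    (fun v h4 h5 => by simp only [dentedSet, Set.mem_ofPred_eq]; omega)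
    (fun v h4 h5 => by simp only [dentedSet, Set.mem_ofPred_eq]; omega)
  have h := h.step (y := 2 * t + 2 - K) (z := 2 * t + 1 - K)
    (by simp only [dentedSet, Set.mem_ofPred_eq, true_or, or_true, and_true]; omega)
    (by omega) (by omega) (by omega)
    (by simp only [dentedSet, Set.mem_ofPred_eq]; omega)
    (fun j h4 h5 => by have := hβ' j h4 h5; omega)
    (fun v h4 h5 => by omega)
    (fun v h4 h5 => by simp only [dentedSet, Set.mem_ofPred_eq]; omega)
  rcases ht.eq_or_lt with rfl | ht
  · refine (h.settle fun v hv => ?_).congr fun v => ?_ <;>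
    simp only [dentedSet, Set.mem_ofPred_eq] <;> omega
  have h := h.step (y := 2 * t - 1 - K) (z := 2 * t - 2 - K)
    (by simp only [dentedSet, Set.mem_ofPred_eq]; omega) (by omega) (by omega) (by omega)
    (by simp only [dentedSet, Set.mem_ofPred_eq]; omega)
    (fun j h4 h5 => by have := hβ' j h4 h5; omega)
    (fun v h4 h5 => by simp only [dentedSet, Set.mem_ofPred_eq]; omega)
    (fun v h4 h5 => by simp only [dentedSet, Set.mem_ofPred_eq]; omega)
  have h := h.cascade_to (-K) (by omega) (by omega) (by omega)
    (fun v _ _ => by simp only [dentedSet, Set.mem_ofPred_eq]; omega)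
    (fun j h4 h5 => by have := hβ' j h4 h5; omega)
  refine (h.settle fun v hv => ?_).congr fun v => ?_ <;>
  simp only [dentedSet, Set.mem_ofPred_eq] <;> omega

theorem reachesSettled_initial {n : ℕ} {u₀ : Equiv.Perm ℤ} (hout : ∀ j : ℤ, j < 0 ∨ n ≤ j → u₀ j = j) :
    ReachesSettled (-n - 1) (n + 1) u₀ (alternatingSet 0) u₀ n := by
  refine ⟨u₀, ⟨fun x hx => hout x (by omega), by omega, by omega, by omega, fun i j hij hj => ?_,
    fun j => ?_, fun _ _ _ => rfl, fun i j hi hij => ?_⟩, fun _ => rfl⟩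
  · rwa [hout i (by omega), hout j (by omega)]
  · simp only [alternatingSet, Set.mem_ofPred_eq]
    constructor
    · intro h
      have := u₀.injective (hout (u₀ j) (by omega))
      omega
    · intro h
      rw [hout j (by omega)]; omega
  · rwa [hout i (by omega), hout j (by omega)]

/-- The reversal of `[0, n)` has the same counts as a Grassmannian permutation. -/
theorem reachesSettled_reversal {n : ℕ} {u₀ : Equiv.Perm ℤ}
    (hout : ∀ j : ℤ, j < 0 ∨ n ≤ j → u₀ j = j)
    (hin : ∀ j : ℤ, 0 ≤ j → j < n → u₀ j = n - 1 - j) :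
    ReachesSettled (-n - 1) (n + 1) u₀ (alternatingSet n) u₀ 0 := by
  have := (reachesSettled_initial hout).insert_range n le_rfl (fun j h1 h2 => hin j (by omega) h2)
    (fun j h1 h2 => by omega) n le_rfl
  rwa [sub_self] at this

/-- The reversal of `[0, n)` with the values `t, t + 1, t + 2` permuted cyclically has the same
counts as a Grassmannian permutation. -/
theorem reachesSettled_reversal_cycle {n t : ℕ} {u₀ : Equiv.Perm ℤ} (htn : t + 3 ≤ n)
    (hout : ∀ j : ℤ, j < 0 ∨ n ≤ j → u₀ j = j)
    (hin : ∀ j : ℤ, 0 ≤ j → j < n → j < n - 3 - t ∨ n - 1 - t < j → u₀ j = n - 1 - j)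
    (h₁ : u₀ (n - 1 - t) = t + 2) (h₂ : u₀ (n - 2 - t) = t) (h₃ : u₀ (n - 3 - t) = t + 1) :
    ReachesSettled (-n - 1) (n + 1) u₀ (dentedSet t n) u₀ 0 := by
  have hβ : ∀ j : ℤ, 0 ≤ j → j < n - 3 - t → u₀ j = n - 1 - j :=
    fun j h4 h5 => hin j h4 (by omega) (by omega)
  have h := (reachesSettled_initial hout).insert_range t (by omega)
    (fun j h4 h5 => hin j (by omega) h5 (by omega))
    (fun j h4 h5 => by
      rcases (by omega : j = n - 1 - t ∨ j = n - 2 - t ∨ j = n - 3 - t ∨ j < n - 3 - t) with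
        rfl | rfl | rfl | h6
      · omega
      · omega
      · omega
      · rw [hβ j h4 h6]; omega) t le_rfl
  have h := h.insert_add_two (by omega) (by omega) h₁ h₂ h₃ hβ
  have h := h.insert_self (by omega) (by omega) h₂ h₃ hβ
  have h := h.insert_add_one (by omega) (by omega) h₃ hβ
  have hK : ∀ i : ℕ, t + 3 + i ≤ n →
      ReachesSettled (-n - 1) (n + 1) u₀ (dentedSet t (t + 3 + i)) u₀ (n - (t + 3 + i)) := by
    intro i
    induction i with
    | zero =>
      intro _
      convert h using 1
      · push_cast; ring_nf
      · push_cast; ring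
    | succ i ih =>
      intro hi
      have := (ih (by omega)).insert_dented (by omega) (by omega) (by omega) hβ
      convert this using 1
      · push_cast; ring_nf
      · push_cast; ring
  have h := hK (n - (t + 3)) (by omega)
  convert h using 1
  · congr 1; omega
  · omega

open Polynomial in
theorem sum_mul_det_vandermonde_update {n : ℕ} (x : Fin n → ℝ) :
    ∑ j, x j * (Matrix.vandermonde (Function.update x j (x j - 1))).det =
      (∑ j, x j - ∑ k : Fin n, (k : ℝ)) * (Matrix.vandermonde x).det := by
  have hdet : ∀ y : Fin n → ℝ, (Matrix.vandermonde y).det =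
      (Matrix.of fun i k : Fin n => (descPochhammer ℝ k).eval (y i)).det := fun y =>
    (Matrix.det_eval_matrixOfPolynomials_eq_det_vandermonde y (fun k => descPochhammer ℝ k)
      (fun k => by simp) (fun k => monic_descPochhammer ℝ k))
  have hP : ∀ (k : ℕ) (z : ℝ), z * (descPochhammer ℝ k).eval (z - 1) =
      (z - k) * (descPochhammer ℝ k).eval z := by
    intro k z
    have h1 := congrArg (eval z) (descPochhammer_succ_left ℝ k)
    rw [descPochhammer_succ_right] at h1
    simp only [eval_mul, eval_sub, eval_X, eval_natCast, eval_comp, eval_one] at h1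
    linarith
  simp only [hdet, Matrix.det_apply', Finset.mul_sum]
  rw [Finset.sum_comm]
  refine Finset.sum_congr rfl fun σ _ => ?_
  have hterm : ∀ j, x j * ((Equiv.Perm.sign σ : ℤ) * ∏ i : Fin n,
      (Matrix.of fun i k : Fin n => (descPochhammer ℝ k).eval
        (Function.update x j (x j - 1) i)) (σ i) i) =
      (x j - (σ.symm j : Fin n)) * ((Equiv.Perm.sign σ : ℤ) * ∏ i : Fin n,
        (Matrix.of fun i k : Fin n => (descPochhammer ℝ k).eval (x i)) (σ i) i) := by
    intro j
    obtain ⟨i, rfl⟩ := σ.surjective j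
    simp only [Matrix.of_apply, Equiv.symm_apply_apply]
    rw [← Finset.mul_prod_erase _ _ (Finset.mem_univ i), ← Finset.mul_prod_erase _
      (fun k : Fin n => (descPochhammer ℝ k).eval (x (σ k))) (Finset.mem_univ i),
      Function.update_self]
    rw [Finset.prod_congr rfl (g := fun k : Fin n => (descPochhammer ℝ k).eval (x (σ k)))
      fun k hk => by
        rw [Function.update_of_ne fun h => (Finset.mem_erase.1 hk).1 (σ.injective h)]]
    linear_combination ((Equiv.Perm.sign σ : ℤ) : ℝ) *
      (∏ k ∈ Finset.univ.erase i, (descPochhammer ℝ k).eval (x (σ k))) * hP i (x (σ i))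
  rw [Finset.sum_congr rfl fun j _ => hterm j, ← Finset.sum_mul, Finset.sum_sub_distrib,
    Equiv.sum_comp σ.symm (fun k : Fin n => (k : ℝ))]

theorem perm_eq_one_of_strictMono {lo hi : ℤ} {u : Equiv.Perm ℤ} (hfix : FixesOutside lo hi u)
    (hmono : StrictMono u) : u = 1 := by
  have hstep : ∀ (k : ℕ) (x : ℤ), u x + k ≤ u (x + k) := by
    intro k
    induction k with
    | zero => simp
    | succ k ih =>
      intro x
      have h1 := ih x
      have h2 := hmono (show x + k < x + (k + 1 : ℕ) by push_cast; omega)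
      push_cast at h2 ⊢
      omega
  ext x
  rw [Equiv.Perm.one_apply]
  by_cases hx : x ≤ lo ∨ hi ≤ x
  · exact hfix x hx
  · have h1 := hstep (x - lo).toNat lo
    have h2 := hstep (hi - x).toNat x
    rw [show lo + ((x - lo).toNat : ℤ) = x by omega, hfix lo (by omega)] at h1
    rw [show x + ((hi - x).toNat : ℤ) = hi by omega, hfix hi (by omega)] at h2
    omega

theorem mem_Ico_of_descent {lo hi i : ℤ} {u : Equiv.Perm ℤ} (hfix : FixesOutside lo hi u)
    (hi' : u.symm (i + 1) < u.symm i) : i ∈ Finset.Ico lo hi := by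
  rw [Finset.mem_Ico]
  by_contra hn
  have h1 := hfix.symm i (by omega)
  have h2 := hfix.symm (i + 1) (by omega)
  omega

/-- The set of values of a Grassmannian permutation at the negative positions. -/
def bead {n : ℕ} (l : Fin n → ℕ) : Set ℤ :=
  {v | v < -n ∨ ∃ i, v = -n + l i}

theorem SettledState.descent_iff {lo hi : ℤ} {u : Equiv.Perm ℤ} {A : Set ℤ} {β : ℤ → ℤ}
    (h : SettledState lo hi u A β 0) (i : ℤ) :
    u.symm (i + 1) < u.symm i ↔ i + 1 ∈ A ∧ i ∉ A := by
  obtain ⟨p, rfl⟩ := u.surjective i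
  obtain ⟨q, hq⟩ := u.surjective (u p + 1)
  rw [← hq, u.symm_apply_apply, u.symm_apply_apply, h.mem_iff, h.mem_iff]
  constructor
  · intro hqp
    by_cases h1 : p < 0
    · have := h.mono_left _ _ hqp h1; omega
    · by_cases h2 : q < 0
      · exact ⟨h2, h1⟩
      · have := h.mono_right _ _ (by omega) hqp; omega
  · omega

theorem SettledState.swap_mul {lo hi : ℤ} {u : Equiv.Perm ℤ} {A : Set ℤ} {β : ℤ → ℤ}
    (h : SettledState lo hi u A β 0) {i : ℤ} (h1 : i + 1 ∈ A) (h2 : i ∉ A) :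
    SettledState lo hi (Equiv.swap i (i + 1) * u) {v | v = i ∨ (v ∈ A ∧ v ≠ i + 1)} β 0 := by
  have hd := (h.descent_iff i).2 ⟨h1, h2⟩
  obtain ⟨p, rfl⟩ := u.surjective i
  obtain ⟨q, hq⟩ := u.surjective (u p + 1)
  have hval : ∀ j, (Equiv.swap (u p) (u p + 1) * u) j =
      if j = p then u p + 1 else if j = q then u p else u j := by
    intro j
    rw [← hq, Equiv.Perm.mul_apply, Equiv.swap_apply_def]
    simp only [u.injective.eq_iff]
  rw [← hq, h.mem_iff] at h1
  rw [h.mem_iff] at h2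
  have inj : ∀ i j, u i = u j → i = j := fun i j e => u.injective e
  refine ⟨h.fixes.swap_mul_of_descent hd, h.lo_neg, h.nonneg, h.lt_hi, ?_, ?_, by omega, ?_⟩
  · intro i j hij hj
    have h3 := h.mono_left i j hij hj
    have h4 := inj i p
    have h5 := inj j q
    rw [hval, hval, if_neg (show i ≠ p by omega), if_neg (show j ≠ p by omega)]
    split_ifs with h6 h7 h7
    · omega
    · subst h6; omega
    · subst h7; omega
    · exact h3
  · intro j
    have h3 := inj j p
    have h4 := inj j q
    rw [hval, Set.mem_ofPred_eq]
    split_ifs with h6 h7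
    · subst h6; omega
    · subst h7; omega
    · rw [h.mem_iff]; omega
  · intro i j hi' hij
    have h3 := h.mono_right i j hi' hij
    have h4 := inj i p
    have h5 := inj j q
    rw [hval, hval, if_neg (show i ≠ q by omega), if_neg (show j ≠ q by omega)]
    have h8 := inj j p
    have h9 := inj j q
    split_ifs with h6 h7 h7
    · omega
    · subst h6; omega
    · subst h7; omega
    · exact h3

theorem det_vandermonde_update_eq_zero {n : ℕ} (l : Fin n → ℕ) (j : Fin n)
    (h : ¬ (1 ≤ l j ∧ ∀ k, l k ≠ l j - 1)) :
    (l j : ℝ) * (Matrix.vandermonde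
      (Function.update (fun i => (l i : ℝ)) j ((l j : ℝ) - 1))).det = 0 := by
  rcases Nat.eq_zero_or_pos (l j) with h0 | h0
  · simp [h0]
  · push Not at h
    obtain ⟨k, hk⟩ := h h0
    have hkj : k ≠ j := by rintro rfl; omega
    rw [(Matrix.det_vandermonde_eq_zero_iff).2 ⟨k, j, ?_, hkj⟩, mul_zero]
    rw [Function.update_self, Function.update_of_ne hkj, hk]
    push_cast [h0]
    ring

theorem SettledState.sum_descents {lo hi : ℤ} {n : ℕ} {l : Fin n → ℕ} (hl : Function.Injective l)
    {u : Equiv.Perm ℤ} {β : ℤ → ℤ} (h : SettledState lo hi u (bead l) β 0) (f : ℤ → ℤ) :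
    (∑ i ∈ Finset.Ico lo hi, if u.symm (i + 1) < u.symm i then f i else 0) =
      ∑ j, if 1 ≤ l j ∧ ∀ k, l k ≠ l j - 1 then f (-n + l j - 1) else 0 := by
  rw [← Finset.sum_filter, ← Finset.sum_filter]
  symm
  refine Finset.sum_nbij (fun j => -n + (l j : ℤ) - 1) ?_ ?_ ?_ (fun _ _ => rfl)
  · intro j hj
    rw [Finset.mem_filter] at hj
    have hd : u.symm (-n + (l j : ℤ) - 1 + 1) < u.symm (-n + (l j : ℤ) - 1) := by
      refine (h.descent_iff _).2 ⟨Or.inr ⟨j, by ring⟩, ?_⟩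
      rintro (h1 | ⟨k, hk⟩)
      · omega
      · exact hj.2.2 k (by omega)
    exact Finset.mem_filter.2 ⟨mem_Ico_of_descent h.fixes hd, hd⟩
  · intro i _ j _ hij
    simp only at hij
    exact hl (by omega)
  · intro i hi'
    rw [Finset.mem_coe, Finset.mem_filter, h.descent_iff] at hi'
    obtain ⟨_, h1 | ⟨j, hj⟩, h2⟩ := hi'
    · exact absurd (Or.inl (by omega)) h2
    · refine ⟨j, ?_, by simp only; omega⟩
      simp only [Finset.coe_filter, Finset.mem_univ, true_and, Set.mem_ofPred_eq]
      refine ⟨?_, fun k hk => ?_⟩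
      · by_contra hn
        exact h2 (Or.inl (by omega))
      · by_cases h0 : l j = 0
        · exact h2 (Or.inl (by omega))
        · exact h2 (Or.inr ⟨k, by omega⟩)

theorem sum_eq_sum_update_pred_add_one {n : ℕ} {l : Fin n → ℕ} {j : Fin n} (hj : 1 ≤ l j) :
    ∑ i, l i = ∑ i, Function.update l j (l j - 1) i + 1 := by
  rw [Finset.sum_update_of_mem (Finset.mem_univ j), ← Finset.add_sum_erase _ _ (Finset.mem_univ j),
    ← Finset.sdiff_singleton_eq_erase]
  omega

theorem prod_factorial_eq_mul_update_pred {n : ℕ} {l : Fin n → ℕ} {j : Fin n} (hj : 1 ≤ l j) :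
    (∏ i, ((l i).factorial : ℝ)) =
      l j * ∏ i, ((Function.update l j (l j - 1) i).factorial : ℝ) := by
  rw [← Finset.mul_prod_erase _ _ (Finset.mem_univ j), ← Finset.mul_prod_erase _
    (fun i => ((Function.update l j (l j - 1) i).factorial : ℝ)) (Finset.mem_univ j),
    Function.update_self, ← mul_assoc]
  congr 1
  · rw [← Nat.cast_mul, Nat.mul_factorial_pred (by omega)]
  · refine Finset.prod_congr rfl fun i hi' => ?_
    rw [Function.update_of_ne (Finset.mem_erase.1 hi').1]

theorem cast_update_pred {n : ℕ} {l : Fin n → ℕ} {j : Fin n} (hj : 1 ≤ l j) :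
    (fun i => ((Function.update l j (l j - 1) i : ℕ) : ℝ)) =
      Function.update (fun i => (l i : ℝ)) j ((l j : ℝ) - 1) := by
  ext i
  rcases eq_or_ne i j with rfl | h2
  · rw [Function.update_self, Function.update_self]
    push_cast [hj]
    rfl
  · rw [Function.update_of_ne h2, Function.update_of_ne h2]

/-- Frobenius' formula for the number of standard tableaux, in terms of `redCount`. -/
theorem redCount_grassmannian (lo hi : ℤ) {n : ℕ} (β : ℤ → ℤ) (m : ℕ) :
    ∀ (l : Fin n → ℕ) (u : Equiv.Perm ℤ), StrictMono l → SettledState lo hi u (bead l) β 0 →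
      ∑ i, l i = m + ∑ k : Fin n, (k : ℕ) →
      (redCount lo hi m u : ℝ) * (∏ i, ((l i).factorial : ℝ)) *
          (Matrix.vandermonde (fun k : Fin n => (k : ℝ))).det =
        (m.factorial : ℝ) * (∏ k : Fin n, ((k : ℕ).factorial : ℝ)) *
          (Matrix.vandermonde (fun i => (l i : ℝ))).det := by
  induction m with
  | zero =>
    intro l u hl h hsum
    have hle : ∀ i : Fin n, (i : ℕ) ≤ l i := by
      rintro ⟨i, hi⟩
      induction i with
      | zero => simp
      | succ i ih =>
        have h1 := ih (by omega)
        have h2 := hl (show (⟨i, by omega⟩ : Fin n) < ⟨i + 1, hi⟩ by simp)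
        simp only at h1 ⊢
        omega
    rw [zero_add] at hsum
    have heq := (Finset.sum_eq_sum_iff_of_le (fun i _ => hle i)).1 hsum.symm
    have hl' : l = fun i : Fin n => (i : ℕ) := funext fun i => (heq i (Finset.mem_univ i)).symm
    subst hl'
    have hmem : ∀ v, v ∈ bead (fun i : Fin n => (i : ℕ)) ↔ v < 0 := by
      intro v
      constructor
      · rintro (h1 | ⟨i, h1⟩)
        · omega
        · have := i.2; simp only at h1; omega
      · intro h1
        by_cases h2 : v < -n
        · exact Or.inl h2
        · exact Or.inr ⟨⟨(v + n).toNat, by omega⟩, by simp only; omega⟩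
    have h1 : u = 1 := by
      refine perm_eq_one_of_strictMono h.fixes fun i j hij => ?_
      by_cases h2 : j < 0
      · exact h.mono_left i j hij h2
      · by_cases h3 : 0 ≤ i
        · exact h.mono_right i j h3 hij
        · have h4 := (hmem _).1 ((h.mem_iff i).2 (by omega))
          have h5 := mt (fun h6 => (h.mem_iff j).1 ((hmem _).2 h6)) h2
          omega
    rw [redCount, if_pos h1]
    simp
  | succ m ih =>
    intro l u hl h hsum
    rw [redCount, h.sum_descents hl.injective]
    push_cast
    rw [Finset.sum_mul, Finset.sum_mul]
    have hterm : ∀ j, ((if 1 ≤ l j ∧ ∀ k, l k ≠ l j - 1 then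
        (redCount lo hi m (Equiv.swap (-(n : ℤ) + (l j : ℤ) - 1) (-(n : ℤ) + (l j : ℤ) - 1 + 1) * u) : ℝ) else 0)) *
          (∏ i, ((l i).factorial : ℝ)) * (Matrix.vandermonde (fun k : Fin n => (k : ℝ))).det =
        (m.factorial : ℝ) * (∏ k : Fin n, ((k : ℕ).factorial : ℝ)) * ((l j : ℝ) *
          (Matrix.vandermonde (Function.update (fun i => (l i : ℝ)) j ((l j : ℝ) - 1))).det) := by
      intro j
      split_ifs with hj
      · have hmono : StrictMono (Function.update l j (l j - 1)) := by
          intro a b hab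
          have h1 := hl hab
          simp only [Function.update_apply]
          have := hj.2 a
          have := hl.injective.eq_iff (a := a) (b := j)
          split_ifs with h2 h3 h3
          · omega
          · subst h2; omega
          · subst h3; omega
          · exact h1
        have hset : {v | v = -n + (l j : ℤ) - 1 ∨ (v ∈ bead l ∧ v ≠ -n + (l j : ℤ) - 1 + 1)} =
            bead (Function.update l j (l j - 1)) := by
          ext v
          constructor
          · rintro (h1 | ⟨h1 | ⟨k, h1⟩, h2⟩)
            · exact Or.inr ⟨j, by rw [Function.update_self]; omega⟩
            · exact Or.inl h1
            · exact Or.inr ⟨k, by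
                rw [Function.update_of_ne]
                · exact h1
                · rintro rfl; omega⟩
          · rintro (h1 | ⟨k, h1⟩)
            · exact Or.inr ⟨Or.inl h1, by omega⟩
            · rcases eq_or_ne k j with rfl | h2
              · rw [Function.update_self] at h1
                left; omega
              · rw [Function.update_of_ne h2] at h1
                refine Or.inr ⟨Or.inr ⟨k, h1⟩, fun h3 => h2 (hl.injective (by omega))⟩
        have hs := h.swap_mul (i := -n + l j - 1) (Or.inr ⟨j, by ring⟩) (by
          rintro (h1 | ⟨k, hk⟩)
          · omega
          · exact hj.2 k (by omega))
        rw [hset] at hs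
        have hsum' : ∑ i, Function.update l j (l j - 1) i = m + ∑ k : Fin n, (k : ℕ) := by
          rw [sum_eq_sum_update_pred_add_one hj.1] at hsum
          omega
        have key := ih _ _ hmono hs hsum'
        rw [cast_update_pred hj.1] at key
        rw [prod_factorial_eq_mul_update_pred hj.1]
        linear_combination (l j : ℝ) * key
      · rw [det_vandermonde_update_eq_zero l j hj]
        ring
    rw [Finset.sum_congr rfl fun j _ => hterm j, ← Finset.mul_sum,
      sum_mul_det_vandermonde_update]
    have : (∑ j, (l j : ℝ)) - ∑ k : Fin n, (k : ℝ) = m + 1 := by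
      have := congrArg (Nat.cast (R := ℝ)) hsum
      push_cast at this
      linarith
    rw [this, Nat.factorial_succ]
    push_cast
    ring

theorem det_vandermonde_eq_prod_erase_mul {n : ℕ} (x : Fin n → ℝ) (e : Fin n) :
    (Matrix.vandermonde x).det = (∏ i ∈ Finset.univ.erase e, (x e - x i)) *
      ((∏ i ∈ Finset.univ.erase e, if e < i then -1 else 1) *
        ∏ i ∈ Finset.univ.erase e, ∏ j ∈ Finset.univ.erase e, if i < j then x j - x i else 1) := by
  have h1 : ∀ i, ∏ j ∈ Finset.Ioi i, (x j - x i) = ∏ j, if i < j then x j - x i else 1 := by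
    intro i
    rw [← Finset.prod_filter]
    congr 1
    ext j; simp
  rw [Matrix.det_vandermonde, Finset.prod_congr rfl fun i _ => h1 i,
    ← Finset.mul_prod_erase _ _ (Finset.mem_univ e),
    Finset.prod_congr rfl fun i _ =>
      (Finset.mul_prod_erase _ (fun j => if i < j then x j - x i else 1) (Finset.mem_univ e)).symm,
    Finset.prod_mul_distrib, ← Finset.mul_prod_erase _ (fun j => if e < j then x j - x e else 1)
      (Finset.mem_univ e), if_neg (lt_irrefl e), one_mul, ← mul_assoc, ← mul_assoc,
    ← Finset.prod_mul_distrib, ← Finset.prod_mul_distrib, ← Finset.prod_mul_distrib,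
    ← Finset.prod_mul_distrib]
  refine Finset.prod_congr rfl fun i hi => ?_
  rcases lt_or_gt_of_ne (Finset.mem_erase.1 hi).1 with h | h
  · rw [if_neg h.not_gt, if_pos h, if_neg h.not_gt]; ring
  · rw [if_pos h, if_neg h.not_gt, if_pos h]; ring

theorem det_vandermonde_update {n : ℕ} {x : Fin n → ℝ} (hx : Function.Injective x) (e : Fin n)
    (y : ℝ) : (Matrix.vandermonde (Function.update x e y)).det = (Matrix.vandermonde x).det *
      ∏ i ∈ Finset.univ.erase e, (y - x i) / (x e - x i) := by
  have hne : ∏ i ∈ Finset.univ.erase e, (x e - x i) ≠ 0 :=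
    Finset.prod_ne_zero_iff.2 fun i hi h =>
      (Finset.mem_erase.1 hi).1 (hx (sub_eq_zero.1 h).symm)
  have hup : ∀ i ∈ Finset.univ.erase e, Function.update x e y i = x i :=
    fun i hi => Function.update_of_ne (Finset.mem_erase.1 hi).1 _ _
  have h1 : ∏ i ∈ Finset.univ.erase e, (y - Function.update x e y i) =
      ∏ i ∈ Finset.univ.erase e, (y - x i) :=
    Finset.prod_congr rfl fun i hi => by rw [hup i hi]
  have h2 : (∏ i ∈ Finset.univ.erase e, ∏ j ∈ Finset.univ.erase e,
        if i < j then Function.update x e y j - Function.update x e y i else 1) =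
      ∏ i ∈ Finset.univ.erase e, ∏ j ∈ Finset.univ.erase e, if i < j then x j - x i else 1 :=
    Finset.prod_congr rfl fun i hi => Finset.prod_congr rfl fun j hj => by rw [hup i hi, hup j hj]
  rw [det_vandermonde_eq_prod_erase_mul _ e, det_vandermonde_eq_prod_erase_mul x e,
    Function.update_self, h1, h2, Finset.prod_div_distrib]
  field_simp

theorem prod_erase_eq_prod_range_mul {n : ℕ} (e : Fin n) (f : ℕ → ℝ) :
    ∏ i ∈ Finset.univ.erase e, f i = (∏ d ∈ Finset.range e, f (e - 1 - d)) *
      ∏ d ∈ Finset.range (n - 1 - e), f (e + 1 + d) := by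
  have h1 : ∏ i ∈ Finset.univ.erase e, f i = ∏ i : Fin n, Function.update f e 1 i := by
    rw [← Finset.mul_prod_erase _ _ (Finset.mem_univ e), Function.update_self, one_mul]
    refine Finset.prod_congr rfl fun i hi => ?_
    rw [Function.update_of_ne (fun h => (Finset.mem_erase.1 hi).1 (Fin.ext h))]
  rw [h1, Fin.prod_univ_eq_prod_range (Function.update f e 1) n]
  obtain ⟨M, hM⟩ : ∃ M, n = e + 1 + M := ⟨n - 1 - e, by have := e.2; omega⟩
  clear h1
  generalize (e : ℕ) = k at *
  subst hM
  rw [show k + 1 + M - 1 - k = M by omega, Finset.prod_range_add, Finset.prod_range_succ,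
    Function.update_self, mul_one]
  congr 1
  · rw [Finset.prod_range_reflect f]
    refine Finset.prod_congr rfl fun i hi => ?_
    rw [Function.update_of_ne (Finset.mem_range.1 hi).ne]
  · refine Finset.prod_congr rfl fun i hi => ?_
    rw [Function.update_of_ne (by omega)]

theorem prod_mul_wallis_left (a : ℕ) :
    (∏ d ∈ Finset.range a, ((2 * d + 1 : ℝ) / (2 * d + 2) * ((2 * d + 3) / (2 * d + 4)))) =
      1 / (Real.Wallis.W a * (a + 1)) := by
  induction a with
  | zero => simp [Real.Wallis.W]
  | succ a ih =>
    have := Real.Wallis.W_pos a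
    rw [Finset.prod_range_succ, ih, Real.Wallis.W_succ]
    push_cast
    field_simp
    ring

theorem prod_mul_wallis_right (M : ℕ) :
    (∏ d ∈ Finset.range (M + 1), ((2 * d + 3 : ℝ) / (2 * d + 2))) *
      (∏ d ∈ Finset.range M, ((2 * d + 3 : ℝ) / (2 * d + 2))) =
      2 * (M + 1) / Real.Wallis.W (M + 1) := by
  induction M with
  | zero => norm_num [Real.Wallis.W]
  | succ M ih =>
    have := Real.Wallis.W_pos (M + 1)
    have hA := Finset.prod_range_succ (fun d : ℕ => (2 * d + 3 : ℝ) / (2 * d + 2)) M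
    rw [Finset.prod_range_succ _ (M + 1), Real.Wallis.W_succ]
    generalize ∏ d ∈ Finset.range (M + 1), (2 * d + 3 : ℝ) / (2 * d + 2) = A at *
    generalize ∏ d ∈ Finset.range M, (2 * d + 3 : ℝ) / (2 * d + 2) = B at *
    rw [mul_right_comm]
    nth_rewrite 2 [hA]
    rw [← mul_assoc, ih]
    push_cast
    field_simp
    ring

theorem prod_erase_shift (a M : ℕ) :
    ∏ i ∈ Finset.univ.erase (⟨a, by omega⟩ : Fin (a + 2 + M)),
      ((2 * a - 1 : ℝ) - 2 * (i : ℕ)) / (2 * a - 2 * (i : ℕ)) =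
    (∏ d ∈ Finset.range a, (2 * d + 1 : ℝ) / (2 * d + 2)) *
      ∏ d ∈ Finset.range (M + 1), (2 * d + 3 : ℝ) / (2 * d + 2) := by
  rw [prod_erase_eq_prod_range_mul (⟨a, by omega⟩ : Fin (a + 2 + M))
    (fun k => ((2 * a - 1 : ℝ) - 2 * k) / (2 * a - 2 * k))]
  simp only
  rw [show a + 2 + M - 1 - a = M + 1 by omega]
  congr 1
  · refine Finset.prod_congr rfl fun d hd => ?_
    obtain ⟨k, rfl⟩ : ∃ k, a = d + 1 + k :=
      ⟨a - 1 - d, by have := Finset.mem_range.1 hd; omega⟩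
    rw [show d + 1 + k - 1 - d = k by omega]
    push_cast
    congr 1 <;> ring
  · refine Finset.prod_congr rfl fun d _ => ?_
    rw [← neg_div_neg_eq]
    push_cast
    congr 1 <;> ring

theorem prod_erase_shift_succ (a M : ℕ) :
    ∏ i ∈ Finset.univ.erase (⟨a + 1, by omega⟩ : Fin (a + 2 + M)),
      ((2 * a + 1 : ℝ) - if (i : ℕ) = a then (2 * a - 1 : ℝ) else 2 * ((i : ℕ) : ℝ)) /
        (2 * a + 2 - if (i : ℕ) = a then (2 * a - 1 : ℝ) else 2 * ((i : ℕ) : ℝ)) =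
    (2 / 3) * (∏ d ∈ Finset.range a, (2 * d + 3 : ℝ) / (2 * d + 4)) *
      ∏ d ∈ Finset.range M, (2 * d + 3 : ℝ) / (2 * d + 2) := by
  rw [prod_erase_eq_prod_range_mul (⟨a + 1, by omega⟩ : Fin (a + 2 + M))
    (fun k => ((2 * a + 1 : ℝ) - if k = a then (2 * a - 1 : ℝ) else 2 * (k : ℝ)) /
        (2 * a + 2 - if k = a then (2 * a - 1 : ℝ) else 2 * (k : ℝ)))]
  simp only
  rw [show a + 2 + M - 1 - (a + 1) = M by omega, Finset.prod_range_succ', mul_comm (2 / 3 : ℝ)]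
  congr 1
  · congr 1
    · refine Finset.prod_congr rfl fun d hd => ?_
      obtain ⟨k, rfl⟩ : ∃ k, a = d + 1 + k :=
        ⟨a - 1 - d, by have := Finset.mem_range.1 hd; omega⟩
      rw [show d + 1 + k + 1 - 1 - (d + 1) = k by omega, if_neg (by omega)]
      push_cast
      congr 1 <;> ring
    · rw [if_pos (by omega)]
      ring_nf
  · refine Finset.prod_congr rfl fun d _ => ?_
    rw [← neg_div_neg_eq, if_neg (by omega)]
    push_cast
    congr 1 <;> ring

theorem det_vandermonde_dented (a M : ℕ) :
    (Matrix.vandermonde (Function.update (Function.update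
      (fun i : Fin (a + 2 + M) => 2 * ((i : ℕ) : ℝ)) ⟨a, by omega⟩ (2 * a - 1)) ⟨a + 1, by omega⟩
        (2 * a + 1))).det =
      (Matrix.vandermonde (fun i : Fin (a + 2 + M) => 2 * ((i : ℕ) : ℝ))).det *
        (4 / 3 * ((M + 1) / ((a + 1) * Real.Wallis.W a * Real.Wallis.W (M + 1)))) := by
  have hx : Function.Injective (fun i : Fin (a + 2 + M) => 2 * ((i : ℕ) : ℝ)) := by
    intro i j h
    simp only at h
    exact Fin.ext (by exact_mod_cast (mul_left_cancel₀ two_ne_zero h))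
  have hval : ∀ i : Fin (a + 2 + M), Function.update
      (fun i : Fin (a + 2 + M) => 2 * ((i : ℕ) : ℝ)) ⟨a, by omega⟩ (2 * a - 1) i =
        if (i : ℕ) = a then (2 * a - 1 : ℝ) else 2 * ((i : ℕ) : ℝ) := by
    intro i
    rw [Function.update_apply]
    simp only [Fin.ext_iff]
  have hx' : Function.Injective (Function.update
      (fun i : Fin (a + 2 + M) => 2 * ((i : ℕ) : ℝ)) ⟨a, by omega⟩ (2 * a - 1)) := by
    intro i j h
    rw [hval, hval] at h
    apply Fin.ext
    split_ifs at h with h1 h2 h2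
    · omega
    · have : (2 * a - 1 : ℤ) = 2 * (j : ℕ) := by exact_mod_cast h
      omega
    · have : (2 * (i : ℕ) : ℤ) = 2 * a - 1 := by exact_mod_cast h
      omega
    · exact_mod_cast (mul_left_cancel₀ two_ne_zero h)
  rw [det_vandermonde_update hx', det_vandermonde_update hx]
  simp only [hval]
  rw [if_neg (by omega)]
  push_cast
  have h1 := prod_erase_shift a M
  have h2 := prod_erase_shift_succ a M
  rw [show (2 * ((a : ℝ) + 1)) = 2 * a + 2 by ring, h1, h2, mul_assoc]
  congr 1
  have h3 := prod_mul_wallis_left a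
  have h4 := prod_mul_wallis_right M
  rw [Finset.prod_mul_distrib] at h3
  rw [show ∀ A B C D : ℝ, A * B * (2 / 3 * C * D) = 2 / 3 * (A * C) * (B * D) by intros; ring,
    h3, h4]
  have := Real.Wallis.W_pos a
  have := Real.Wallis.W_pos (M + 1)
  field_simp
  ring

theorem alternatingSet_eq_bead (n : ℕ) :
    alternatingSet n = bead (fun i : Fin n => 2 * (i : ℕ)) := by
  ext v
  simp only [alternatingSet, bead, Set.mem_ofPred_eq]
  refine or_congr Iff.rfl ⟨fun h => ⟨⟨((v + n) / 2).toNat, by omega⟩, by simp only; omega⟩, ?_⟩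
  rintro ⟨i, hi⟩
  have := i.2
  omega

theorem dentedSet_eq_bead (t M : ℕ) :
    dentedSet t (t + 1 + 2 + M : ℕ) = bead (Function.update (Function.update
      (fun i : Fin (t + 1 + 2 + M) => 2 * (i : ℕ)) ⟨t + 1, by omega⟩ (2 * (t + 1) - 1))
        ⟨t + 1 + 1, by omega⟩ (2 * (t + 1 + 1) - 1)) := by
  ext v
  simp only [dentedSet, bead, Set.mem_ofPred_eq, Function.update_apply, Fin.ext_iff]
  refine or_congr Iff.rfl ⟨?_, ?_⟩
  · rintro ⟨h1, h2, ⟨h3, h4⟩ | h3 | h3⟩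
    · refine ⟨⟨((v + (t + 1 + 2 + M : ℕ)) / 2).toNat, by omega⟩, ?_⟩
      simp only
      rw [if_neg (by omega), if_neg (by omega)]
      omega
    · refine ⟨⟨t + 1, by omega⟩, ?_⟩
      simp only
      rw [if_neg (by omega), if_pos trivial]
      omega
    · refine ⟨⟨t + 1 + 1, by omega⟩, ?_⟩
      simp only
      rw [if_pos trivial]
      omega
  · rintro ⟨i, hi⟩
    have := i.2
    split_ifs at hi <;> omega

/-- The count for the reversal with the values `t, t + 1, t + 2` permuted cyclically, relative to
the count for the reversal. -/
theorem redCount_reversal_cycle {n t M : ℕ} (hn : n = t + 1 + 2 + M) {u₀ u₁ : Equiv.Perm ℤ}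
    (hout₀ : ∀ j : ℤ, j < 0 ∨ n ≤ j → u₀ j = j)
    (hin₀ : ∀ j : ℤ, 0 ≤ j → j < n → u₀ j = n - 1 - j)
    (hout₁ : ∀ j : ℤ, j < 0 ∨ n ≤ j → u₁ j = j)
    (hin₁ : ∀ j : ℤ, 0 ≤ j → j < n → j < n - 3 - t ∨ n - 1 - t < j → u₁ j = n - 1 - j)
    (h₁ : u₁ (n - 1 - t) = t + 2) (h₂ : u₁ (n - 2 - t) = t) (h₃ : u₁ (n - 3 - t) = t + 1)
    {N : ℕ} (hN : N + 2 = ∑ k : Fin n, (k : ℕ)) :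
    (redCount (-n - 1) (n + 1) N u₁ : ℝ) * ((N + 2) * (N + 1)) =
      redCount (-n - 1) (n + 1) (N + 2) u₀ * (16 / 3 * ((t + 1) / Real.Wallis.W (t + 1)) *
        ((M + 1) / Real.Wallis.W (M + 1))) := by
  obtain ⟨v₀, hv₀, hc₀⟩ := reachesSettled_reversal hout₀ hin₀
  obtain ⟨v₁, hv₁, hc₁⟩ := reachesSettled_reversal_cycle (by omega) hout₁ hin₁ h₁ h₂ h₃
  rw [← hc₀, ← hc₁]
  subst hn
  rw [alternatingSet_eq_bead] at hv₀
  rw [dentedSet_eq_bead] at hv₁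
  set l₀ : Fin (t + 1 + 2 + M) → ℕ := fun i => 2 * (i : ℕ) with hl₀
  set e₁ : Fin (t + 1 + 2 + M) := ⟨t + 1, by omega⟩ with he₁
  set e₂ : Fin (t + 1 + 2 + M) := ⟨t + 1 + 1, by omega⟩ with he₂
  have hne : e₂ ≠ e₁ := by simp [he₁, he₂]
  have k₁ : 1 ≤ l₀ e₁ := by simp only [hl₀, he₁]; omega
  have d₁ : 2 * (t + 1) - 1 = l₀ e₁ - 1 := rfl
  rw [d₁] at hv₁
  set l₁ := Function.update l₀ e₁ (l₀ e₁ - 1) with hl₁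
  have v₂ : l₁ e₂ = 2 * (t + 1 + 1) := by rw [hl₁, Function.update_of_ne hne]
  have k₂ : 1 ≤ l₁ e₂ := by omega
  rw [← v₂] at hv₁
  set l₂ := Function.update l₁ e₂ (l₁ e₂ - 1) with hl₂
  have hsum₀ : ∑ i, l₀ i = (N + 2) + ∑ k : Fin (t + 1 + 2 + M), (k : ℕ) := by
    rw [hl₀, ← Finset.mul_sum, ← hN]; ring
  have hsum₂ : ∑ i, l₂ i = N + ∑ k : Fin (t + 1 + 2 + M), (k : ℕ) := by
    have s₁ : ∑ i, l₀ i = ∑ i, l₁ i + 1 := sum_eq_sum_update_pred_add_one k₁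
    have s₂ : ∑ i, l₁ i = ∑ i, l₂ i + 1 := sum_eq_sum_update_pred_add_one k₂
    omega
  have hmono₀ : StrictMono l₀ := by
    intro i j hij
    simp only [hl₀]
    omega
  have hmono₂ : StrictMono l₂ := by
    intro i j hij
    simp only [hl₂, hl₁, hl₀, Function.update_apply, he₁, he₂, Fin.ext_iff]
    rw [Fin.lt_def] at hij
    split_ifs <;> omega
  have F₀ := redCount_grassmannian _ _ u₀ (N + 2) l₀ v₀ hmono₀ hv₀ hsum₀
  have F₂ := redCount_grassmannian _ _ u₁ N l₂ v₁ hmono₂ hv₁ hsum₂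
  have P₁ : ∏ i, ((l₀ i).factorial : ℝ) =
      (2 * (t + 1) : ℕ) * ∏ i, ((l₁ i).factorial : ℝ) := prod_factorial_eq_mul_update_pred k₁
  have P₂ : ∏ i, ((l₁ i).factorial : ℝ) =
      (2 * (t + 1 + 1) : ℕ) * ∏ i, ((l₂ i).factorial : ℝ) := by
    rw [← v₂]
    exact prod_factorial_eq_mul_update_pred k₂
  rw [P₁, P₂] at F₀
  have hD := det_vandermonde_dented (t + 1) M
  rw [show (fun i => (l₂ i : ℝ)) = _ from cast_update_pred k₂, cast_update_pred k₁, v₂,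
    show l₀ e₁ = 2 * (t + 1) from rfl, show (fun i => (l₀ i : ℝ)) =
      fun i : Fin (t + 1 + 2 + M) => 2 * ((i : ℕ) : ℝ) by ext i; simp [hl₀],
    show ((2 * (t + 1) : ℕ) : ℝ) - 1 = 2 * (t + 1 : ℕ) - 1 by push_cast; ring,
    show ((2 * (t + 1 + 1) : ℕ) : ℝ) - 1 = 2 * (t + 1 : ℕ) + 1 by push_cast; ring, hD] at F₂
  rw [show (fun i => (l₀ i : ℝ)) =
      fun i : Fin (t + 1 + 2 + M) => 2 * ((i : ℕ) : ℝ) by ext i; simp [hl₀]] at F₀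
  have hfac : (∏ i, ((l₂ i).factorial : ℝ)) ≠ 0 :=
    Finset.prod_ne_zero_iff.2 fun i _ => by positivity
  have hV : (Matrix.vandermonde (fun k : Fin (t + 1 + 2 + M) => (k : ℝ))).det ≠ 0 :=
    Matrix.det_vandermonde_ne_zero_iff.2 fun i j h => Fin.ext (by exact_mod_cast h)
  rw [show (N + 2).factorial = (N + 2) * ((N + 1) * N.factorial) from rfl] at F₀
  have hW := Real.Wallis.W_pos (t + 1)
  have hW' := Real.Wallis.W_pos (M + 1)
  refine mul_right_cancel₀ (mul_ne_zero hfac hV) ?_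
  push_cast at F₀ F₂ ⊢
  generalize Real.Wallis.W (t + 1) = w at *
  generalize Real.Wallis.W (M + 1) = w' at *
  generalize (∏ i, ((l₂ i).factorial : ℝ)) = p at *
  generalize (Matrix.vandermonde (fun k : Fin (t + 1 + 2 + M) => (k : ℝ))).det = V at *
  have ht : (t : ℝ) + 1 + 1 ≠ 0 := by positivity
  rw [show 16 / 3 * (((t : ℝ) + 1) / w) * ((M + 1) / w') = 2 * (t + 1) *
    (2 * (t + 1 + 1)) * (4 / 3 * ((M + 1) / ((t + 1 + 1) * w * w'))) by
      field_simp; ring]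
  linear_combination ((N : ℝ) + 2) * (N + 1) * F₂ -
    (4 / 3 * (((M : ℝ) + 1) / ((t + 1 + 1) * w * w'))) * F₀

theorem redCount_reversal_pos {n : ℕ} {u₀ : Equiv.Perm ℤ}
    (hout : ∀ j : ℤ, j < 0 ∨ n ≤ j → u₀ j = j)
    (hin : ∀ j : ℤ, 0 ≤ j → j < n → u₀ j = n - 1 - j) :
    (0 : ℝ) < redCount (-n - 1) (n + 1) (∑ k : Fin n, (k : ℕ)) u₀ := by
  obtain ⟨v, hv, hc⟩ := reachesSettled_reversal hout hin
  rw [← hc]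
  rw [alternatingSet_eq_bead] at hv
  have hmono : StrictMono (fun i : Fin n => 2 * (i : ℕ)) := fun i j hij => by
    simp only
    omega
  have F := redCount_grassmannian _ _ _ (∑ k : Fin n, (k : ℕ)) _ v hmono hv
    (by rw [← Finset.mul_sum]; ring)
  have hpos : ∀ f : Fin n → ℕ, StrictMono f →
      0 < (Matrix.vandermonde (fun i => (f i : ℝ))).det := by
    intro f hf
    rw [Matrix.det_vandermonde]
    refine Finset.prod_pos fun i _ => Finset.prod_pos fun j hj => ?_
    have : f i < f j := hf (Finset.mem_Ioi.1 hj)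
    exact sub_pos.2 (by exact_mod_cast this)
  have h1 := hpos _ hmono
  have h2 := hpos (fun k => (k : ℕ)) Fin.val_strictMono
  have h3 : 0 < ∏ i : Fin n, ((2 * (i : ℕ)).factorial : ℝ) :=
    Finset.prod_pos fun i _ => by positivity
  have h4 : 0 < ∏ i : Fin n, ((i : ℕ).factorial : ℝ) :=
    Finset.prod_pos fun i _ => by positivity
  have h5 : (0 : ℝ) < ((∑ k : Fin n, (k : ℕ)).factorial : ℝ) := by positivity
  have h6 := mul_pos (mul_pos h5 h4) h1
  rw [← F, mul_assoc] at h6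
  exact pos_of_mul_pos_left h6 (mul_pos h3 h2).le

/-- The words of length `m` for `w`. -/
def wordsOfLength (n : ℕ) : ℕ → Equiv.Perm (Fin n) → Finset (List ℕ)
  | 0, w => if w = 1 then {[]} else ∅
  | m + 1, w => (Finset.Ico 1 n).biUnion fun i =>
      (wordsOfLength n m (simpleRefl n i * w)).image (List.cons i)

theorem simpleRefl_mul_self (n i : ℕ) : simpleRefl n i * simpleRefl n i = 1 := by
  unfold simpleRefl
  split_ifs
  · exact Equiv.swap_mul_self _ _
  · exact mul_one 1

theorem wordProd_cons (n i : ℕ) (l : List ℕ) :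
    wordProd n (i :: l) = simpleRefl n i * wordProd n l := by
  simp [wordProd]

theorem wordProd_append (n : ℕ) (l l' : List ℕ) :
    wordProd n (l ++ l') = wordProd n l * wordProd n l' := by
  simp [wordProd]

theorem isWordFor_cons {n i : ℕ} {l : List ℕ} {w : Equiv.Perm (Fin n)} :
    IsWordFor n w (i :: l) ↔ i ∈ Finset.Ico 1 n ∧ IsWordFor n (simpleRefl n i * w) l := by
  have h : simpleRefl n i * wordProd n l = w ↔ wordProd n l = simpleRefl n i * w := by
    constructor
    · rintro rfl
      rw [← mul_assoc, simpleRefl_mul_self, one_mul]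
    · intro h
      rw [h, ← mul_assoc, simpleRefl_mul_self, one_mul]
  have h' : (1 ≤ i ∧ i ≤ n - 1) ↔ i ∈ Finset.Ico 1 n := by
    rw [Finset.mem_Ico]; omega
  simp only [IsWordFor, List.forall_mem_cons, wordProd_cons, h, h', and_assoc]

theorem mem_wordsOfLength {n m : ℕ} {w : Equiv.Perm (Fin n)} {l : List ℕ} :
    l ∈ wordsOfLength n m w ↔ l.length = m ∧ IsWordFor n w l := by
  induction m generalizing w l with
  | zero =>
    have : l ∈ wordsOfLength n 0 w ↔ w = 1 ∧ l = [] := by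
      unfold wordsOfLength
      split_ifs with h <;> simp [h]
    rw [this, List.length_eq_zero_iff]
    constructor
    · rintro ⟨rfl, rfl⟩
      simp [IsWordFor, wordProd]
    · rintro ⟨rfl, -, h⟩
      exact ⟨h.symm, rfl⟩
  | succ m ih =>
    rw [wordsOfLength, Finset.mem_biUnion]
    constructor
    · rintro ⟨i, hi, h⟩
      obtain ⟨l', hl', rfl⟩ := Finset.mem_image.1 h
      obtain ⟨h1, h2⟩ := ih.1 hl'
      exact ⟨by simp [h1], isWordFor_cons.2 ⟨hi, h2⟩⟩
    · rintro ⟨h1, h2⟩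
      cases l with
      | nil => simp at h1
      | cons i l' =>
        obtain ⟨hi, h3⟩ := isWordFor_cons.1 h2
        exact ⟨i, hi, Finset.mem_image_of_mem _ (ih.2 ⟨by simpa using h1, h3⟩)⟩

theorem card_wordsOfLength_succ (n m : ℕ) (w : Equiv.Perm (Fin n)) :
    (wordsOfLength n (m + 1) w).card =
      ∑ i ∈ Finset.Ico 1 n, (wordsOfLength n m (simpleRefl n i * w)).card := by
  rw [wordsOfLength, Finset.card_biUnion]
  · exact Finset.sum_congr rfl fun i _ =>
      Finset.card_image_of_injective _ (List.cons_injective)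
  · intro i _ j _ hij
    refine Finset.disjoint_left.2 fun l hl hl' => hij ?_
    obtain ⟨a, -, rfl⟩ := Finset.mem_image.1 hl
    obtain ⟨b, -, h⟩ := Finset.mem_image.1 hl'
    exact (List.cons.inj h).1.symm

/-- The inversions of `w`, as pairs of values. -/
def inversionPairs {n : ℕ} (w : Equiv.Perm (Fin n)) : Finset (Fin n × Fin n) :=
  Finset.univ.filter fun p => p.1 < p.2 ∧ w.symm p.2 < w.symm p.1

theorem card_inversionPairs_erase_le {n : ℕ} (w : Equiv.Perm (Fin n)) {a b : Fin n}
    (hab : (b : ℕ) = a + 1) : ((inversionPairs w).erase (a, b)).card ≤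
      ((inversionPairs (Equiv.swap a b * w)).erase (a, b)).card := by
  refine Finset.card_le_card_of_injOn
    (fun p => (Equiv.swap a b p.1, Equiv.swap a b p.2)) ?_ ?_
  · rintro ⟨x, y⟩ hp
    simp only [Finset.coe_erase, Set.mem_sdiff, Finset.mem_coe, inversionPairs, Finset.mem_filter,
      Finset.mem_univ, true_and, Set.mem_singleton_iff, Prod.mk.injEq] at hp ⊢
    have hs : ∀ z, (Equiv.swap a b * w).symm (Equiv.swap a b z) = w.symm z := by
      intro z
      rw [Equiv.symm_apply_eq, Equiv.Perm.mul_apply, Equiv.apply_symm_apply]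
    obtain ⟨⟨hxy, hlt⟩, hne⟩ := hp
    rw [hs, hs]
    simp only [Equiv.swap_apply_def]
    refine ⟨⟨?_, hlt⟩, ?_⟩
    · split_ifs <;> grind
    · split_ifs <;> grind
  · rintro ⟨x, y⟩ _ ⟨x', y'⟩ _ h
    simpa using h

theorem card_inversionPairs_le {n : ℕ} (w : Equiv.Perm (Fin n)) {a b : Fin n}
    (hab : (b : ℕ) = a + 1) :
    (inversionPairs w).card ≤ (inversionPairs (Equiv.swap a b * w)).card + 1 := by
  have h1 := card_inversionPairs_erase_le w hab
  have h2 := Finset.pred_card_le_card_erase (s := inversionPairs w) (a := (a, b))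
  have h3 := Finset.card_erase_le (s := inversionPairs (Equiv.swap a b * w)) (a := (a, b))
  omega

theorem card_inversionPairs_lt {n : ℕ} (w : Equiv.Perm (Fin n)) {a b : Fin n}
    (hab : (b : ℕ) = a + 1) (h : w.symm a < w.symm b) :
    (inversionPairs w).card < (inversionPairs (Equiv.swap a b * w)).card := by
  have h1 := card_inversionPairs_erase_le w hab
  have h2 : (a, b) ∉ inversionPairs w := by
    simp only [inversionPairs, Finset.mem_filter, not_and, not_lt]
    exact fun _ _ => h.le
  have h3 : (a, b) ∈ inversionPairs (Equiv.swap a b * w) := by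
    simp only [inversionPairs, Finset.mem_filter, Finset.mem_univ, true_and]
    refine ⟨by rw [Fin.lt_def]; omega, ?_⟩
    have e1 : (Equiv.swap a b * w).symm b = w.symm a := by
      rw [Equiv.symm_apply_eq, Equiv.Perm.mul_apply, Equiv.apply_symm_apply,
        Equiv.swap_apply_left]
    have e2 : (Equiv.swap a b * w).symm a = w.symm b := by
      rw [Equiv.symm_apply_eq, Equiv.Perm.mul_apply, Equiv.apply_symm_apply,
        Equiv.swap_apply_right]
    rwa [e1, e2]
  rw [Finset.erase_eq_of_notMem h2] at h1
  have h4 := Finset.card_erase_lt_of_mem h3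
  omega

theorem wordsOfLength_eq_empty {n m : ℕ} {w : Equiv.Perm (Fin n)}
    (h : m < (inversionPairs w).card) : wordsOfLength n m w = ∅ := by
  induction m generalizing w with
  | zero =>
    unfold wordsOfLength
    rw [if_neg]
    rintro rfl
    rw [inversionPairs, Finset.filter_false_of_mem] at h
    · simp at h
    · rintro p -
      exact fun ⟨h1, h2⟩ => h1.not_gt h2
  | succ m ih =>
    rw [← Finset.card_eq_zero, card_wordsOfLength_succ]
    refine Finset.sum_eq_zero fun i hi => ?_
    rw [Finset.mem_Ico] at hi
    rw [ih, Finset.card_empty]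
    rw [simpleRefl, dif_pos hi]
    have := card_inversionPairs_le w (a := ⟨i - 1, by omega⟩) (b := ⟨i, hi.2⟩) (by simp only; omega)
    omega

/-- `g` is the extension of `w` to the integers by the identity. -/
def IsExtension {n : ℕ} (w : Equiv.Perm (Fin n)) (g : Equiv.Perm ℤ) : Prop :=
  (∀ j : ℤ, j < 0 ∨ n ≤ j → g j = j) ∧ ∀ i : Fin n, g i = w i

theorem IsExtension.swap_mul {n : ℕ} {w : Equiv.Perm (Fin n)} {g : Equiv.Perm ℤ}
    (h : IsExtension w g) {i : ℕ} (hi : i + 1 < n) :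
    IsExtension (simpleRefl n (i + 1) * w) (Equiv.swap (i : ℤ) (i + 1) * g) := by
  refine ⟨fun j hj => ?_, fun j => ?_⟩
  · rw [Equiv.Perm.mul_apply, h.1 j hj, Equiv.swap_apply_of_ne_of_ne] <;> omega
  · rw [Equiv.Perm.mul_apply, h.2, simpleRefl, dif_pos ⟨by omega, hi⟩, Equiv.Perm.mul_apply]
    simp only [Equiv.swap_apply_def, Fin.ext_iff, Nat.add_sub_cancel]
    split_ifs <;> (try dsimp only) <;> omega

theorem IsExtension.symm_apply {n : ℕ} {w : Equiv.Perm (Fin n)} {g : Equiv.Perm ℤ}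
    (h : IsExtension w g) (i : Fin n) : g.symm i = w.symm i := by
  rw [Equiv.symm_apply_eq, h.2, Equiv.apply_symm_apply]

theorem IsExtension.fixesOutside {n : ℕ} {w : Equiv.Perm (Fin n)} {g : Equiv.Perm ℤ}
    (h : IsExtension w g) : FixesOutside (-1) n g :=
  fun j hj => h.1 j (by omega)

theorem card_wordsOfLength_eq_redCount {n m : ℕ} {w : Equiv.Perm (Fin n)} {g : Equiv.Perm ℤ}
    (hg : IsExtension w g) (h : m ≤ (inversionPairs w).card) :
    ((wordsOfLength n m w).card : ℤ) = redCount (-n - 1) (n + 1) m g := by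
  induction m generalizing w g with
  | zero =>
    have hiff : w = 1 ↔ g = 1 := by
      constructor
      · rintro rfl
        ext j
        rw [Equiv.Perm.one_apply]
        by_cases hj : j < 0 ∨ n ≤ j
        · exact hg.1 j hj
        · have := hg.2 ⟨j.toNat, by omega⟩
          simp only [Equiv.Perm.one_apply] at this
          rwa [Int.toNat_of_nonneg (by omega)] at this
      · rintro rfl
        ext i
        have := hg.2 i
        simp only [Equiv.Perm.one_apply] at this ⊢
        omega
    unfold wordsOfLength redCount
    simp only [hiff]
    split_ifs <;> simp
  | succ m ih =>
    rw [card_wordsOfLength_succ, redCount]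
    push_cast
    have hsub : (Finset.Ico (0 : ℤ) (n - 1)) ⊆ Finset.Ico (-n - 1 : ℤ) (n + 1) :=
      Finset.Ico_subset_Ico (by omega) (by omega)
    rw [← Finset.sum_subset hsub]
    · refine Finset.sum_bij' (fun i _ => (i : ℤ) - 1) (fun j _ => j.toNat + 1) ?_ ?_ ?_ ?_ ?_
      · intro i hi
        simp only [Finset.mem_Ico] at hi ⊢
        omega
      · intro j hj
        simp only [Finset.mem_Ico] at hj ⊢
        omega
      · intro i hi
        simp only [Finset.mem_Ico] at hi ⊢
        omega
      · intro j hj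
        simp only [Finset.mem_Ico] at hj ⊢
        omega
      · intro i hi
        rw [Finset.mem_Ico] at hi
        obtain ⟨i, rfl⟩ : ∃ k, i = k + 1 := ⟨i - 1, by omega⟩
        have ha := hg.symm_apply ⟨i, by omega⟩
        have hb := hg.symm_apply ⟨i + 1, hi.2⟩
        push_cast at ha hb
        have hs : simpleRefl n (i + 1) = Equiv.swap ⟨i, by omega⟩ ⟨i + 1, hi.2⟩ := by
          rw [simpleRefl, dif_pos hi]
          rfl
        rw [show ((i + 1 : ℕ) : ℤ) - 1 = i by push_cast; ring, ha, hb]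
        split_ifs with hd
        · refine ih (hg.swap_mul hi.2) ?_
          have := card_inversionPairs_le w (a := ⟨i, by omega⟩) (b := ⟨i + 1, hi.2⟩) rfl
          rw [hs]
          omega
        · have hne : w.symm ⟨i, by omega⟩ ≠ w.symm ⟨i + 1, hi.2⟩ := by simp
          have := card_inversionPairs_lt w (a := ⟨i, by omega⟩) (b := ⟨i + 1, hi.2⟩) rfl (by
            rw [Fin.lt_def]
            rw [Ne, Fin.ext_iff] at hne
            omega)
          rw [wordsOfLength_eq_empty]
          · simp
          · rw [hs]
            omega
    · intro j _ hj
      rw [if_neg]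
      intro hd
      have h1 := mem_Ico_of_descent hg.fixesOutside hd
      rw [Finset.mem_Ico] at h1 hj
      have h2 : j = -1 ∨ j = n - 1 := by omega
      have h3 : ∀ x : ℤ, 0 ≤ g.symm x ∧ g.symm x < n ∨ g.symm x = x := by
        intro x
        by_cases hx : g.symm x < 0 ∨ n ≤ g.symm x
        · right
          have := hg.1 _ hx
          rw [Equiv.apply_symm_apply] at this
          exact this.symm
        · left; omega
      have h4 : ∀ x : ℤ, x < 0 ∨ n ≤ x → g.symm x = x := fun x hx => by
        rw [Equiv.symm_apply_eq, hg.1 x hx]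
      have h5 := h3 j
      have h6 := h3 (j + 1)
      have h7 := h4 j
      have h8 := h4 (j + 1)
      omega

theorem card_inversionPairs_w₀ (n : ℕ) : (inversionPairs (w₀ n)).card = ∑ k : Fin n, (k : ℕ) := by
  have h : ∀ p : Fin n × Fin n,
      (p.1 < p.2 ∧ (w₀ n).symm p.2 < (w₀ n).symm p.1) ↔ p.1 < p.2 := by
    intro p
    simp [w₀]
  rw [inversionPairs, Finset.filter_congr fun p _ => h p, Finset.card_filter,
    Fintype.sum_prod_type_right]
  refine Finset.sum_congr rfl fun b _ => ?_
  rw [← Finset.card_filter, ← Fin.card_Iio b]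
  congr 1
  ext
  simp

/-- The reversal of `[0, n)`, extended to the integers by the identity. -/
def intReversal (n : ℕ) : Equiv.Perm ℤ :=
  Function.Involutive.toPerm (fun j => if 0 ≤ j ∧ j < n then n - 1 - j else j) fun j => by
    simp only
    split_ifs <;> omega

theorem intReversal_apply (n : ℕ) (j : ℤ) :
    intReversal n j = if 0 ≤ j ∧ j < n then n - 1 - j else j := rfl

theorem isExtension_intReversal (n : ℕ) : IsExtension (w₀ n) (intReversal n) := by
  refine ⟨fun j hj => ?_, fun i => ?_⟩
  · rw [intReversal_apply, if_neg (by omega)]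
  · rw [intReversal_apply, if_pos (by omega), w₀, Fin.revPerm_apply, Fin.val_rev]
    omega

theorem intReversal_of_out {n : ℕ} {j : ℤ} (hj : j < 0 ∨ n ≤ j) : intReversal n j = j := by
  rw [intReversal_apply, if_neg (by omega)]

theorem intReversal_of_in {n : ℕ} {j : ℤ} (h0 : 0 ≤ j) (hn : j < n) :
    intReversal n j = n - 1 - j := by
  rw [intReversal_apply, if_pos ⟨h0, hn⟩]

theorem card_wordsOfLength_w₀ (n : ℕ) :
    ((wordsOfLength n (∑ k : Fin n, (k : ℕ)) (w₀ n)).card : ℤ) =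
      redCount (-n - 1) (n + 1) (∑ k : Fin n, (k : ℕ)) (intReversal n) :=
  card_wordsOfLength_eq_redCount (isExtension_intReversal n) (card_inversionPairs_w₀ n).ge

theorem card_wordsOfLength_w₀_pos (n : ℕ) :
    0 < (wordsOfLength n (∑ k : Fin n, (k : ℕ)) (w₀ n)).card := by
  have h := redCount_reversal_pos (n := n) (u₀ := intReversal n)
    (fun j hj => intReversal_of_out hj) (fun j h0 hn => intReversal_of_in h0 hn)
  rw [← card_wordsOfLength_w₀] at h
  exact_mod_cast h

theorem isReducedWordFor_w₀_iff (n : ℕ) (l : List ℕ) :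
    l ∈ wordsOfLength n (∑ k : Fin n, (k : ℕ)) (w₀ n) ↔ IsReducedWordFor n (w₀ n) l := by
  have hle : ∀ l', IsWordFor n (w₀ n) l' → ∑ k : Fin n, (k : ℕ) ≤ l'.length := by
    intro l' hl'
    by_contra! h
    have h1 : l' ∈ wordsOfLength n l'.length (w₀ n) := mem_wordsOfLength.2 ⟨rfl, hl'⟩
    rw [wordsOfLength_eq_empty (by rwa [card_inversionPairs_w₀])] at h1
    simp at h1
  rw [mem_wordsOfLength]
  constructor
  · rintro ⟨h1, h2⟩
    exact ⟨h2, fun l' hl' => h1 ▸ hle l' hl'⟩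
  · rintro ⟨h1, h2⟩
    obtain ⟨l', hl'⟩ := Finset.card_pos.1 (card_wordsOfLength_w₀_pos n)
    obtain ⟨h3, h4⟩ := mem_wordsOfLength.1 hl'
    exact ⟨le_antisymm (h3 ▸ h2 l' h4) (hle l h1), h1⟩

theorem card_wordsOfLength_cycle {n t M N : ℕ} (hn : n = t + 1 + 2 + M)
    (hN : N + 2 = ∑ k : Fin n, (k : ℕ)) :
    ((wordsOfLength n N (simpleRefl n (t + 2) * (simpleRefl n (t + 1) * w₀ n))).card : ℝ) *
        ((N + 2) * (N + 1)) =
      (wordsOfLength n (N + 2) (w₀ n)).card * (16 / 3 * ((t + 1) / Real.Wallis.W (t + 1)) *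
        ((M + 1) / Real.Wallis.W (M + 1))) := by
  have e₁ := (isExtension_intReversal n).swap_mul (i := t) (by omega)
  have e₂ := e₁.swap_mul (i := t + 1) (by omega)
  set u₁ := Equiv.swap ((t + 1 : ℕ) : ℤ) ((t + 1 : ℕ) + 1) *
    (Equiv.swap (t : ℤ) (t + 1) * intReversal n) with hu₁
  have hu : ∀ j, u₁ j = Equiv.swap ((t + 1 : ℕ) : ℤ) ((t + 1 : ℕ) + 1)
      (Equiv.swap (t : ℤ) (t + 1) (intReversal n j)) := fun j => rfl
  have hlen : N ≤ (inversionPairs (simpleRefl n (t + 2) *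
      (simpleRefl n (t + 1) * w₀ n))).card := by
    have h0 := card_inversionPairs_w₀ n
    have h1 := card_inversionPairs_le (w₀ n) (a := ⟨t, by omega⟩) (b := ⟨t + 1, by omega⟩) rfl
    have h2 := card_inversionPairs_le (simpleRefl n (t + 1) * w₀ n) (a := ⟨t + 1, by omega⟩)
      (b := ⟨t + 2, by omega⟩) rfl
    have s1 : simpleRefl n (t + 1) = Equiv.swap ⟨t, by omega⟩ ⟨t + 1, by omega⟩ := by
      rw [simpleRefl, dif_pos (by omega)]
      rfl
    have s2 : simpleRefl n (t + 2) = Equiv.swap ⟨t + 1, by omega⟩ ⟨t + 2, by omega⟩ := by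
      rw [simpleRefl, dif_pos (by omega)]
      rfl
    rw [← s1] at h1
    rw [← s2] at h2
    omega
  have c₁ := card_wordsOfLength_eq_redCount e₂ hlen
  have c₀ := card_wordsOfLength_w₀ n
  rw [← hN] at c₀
  have key := redCount_reversal_cycle hn (u₀ := intReversal n) (u₁ := u₁)
    (fun j hj => intReversal_of_out hj) (fun j h0 hn => intReversal_of_in h0 hn)
    e₂.1 ?_ ?_ ?_ ?_ hN
  · rw [← c₀, ← c₁] at key
    exact_mod_cast key
  · intro j h0 h1 h2
    rw [hu, intReversal_of_in h0 h1]
    simp only [Equiv.swap_apply_def]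
    split_ifs <;> omega
  all_goals
    rw [hu, intReversal_of_in (by omega) (by omega)]
    simp only [Equiv.swap_apply_def]
    split_ifs <;> omega

theorem card_wordsOfLength_filter_succ (n m : ℕ) (w : Equiv.Perm (Fin n)) :
    ((wordsOfLength n (m + 2) w).filter fun l => l.getD 1 0 = l.getD 0 0 + 1).card =
      ∑ t ∈ Finset.range (n - 2),
        (wordsOfLength n m (simpleRefl n (t + 2) * (simpleRefl n (t + 1) * w))).card := by
  have h : ((wordsOfLength n (m + 2) w).filter fun l => l.getD 1 0 = l.getD 0 0 + 1) =
      (Finset.range (n - 2)).biUnion fun t =>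
        (wordsOfLength n m (simpleRefl n (t + 2) * (simpleRefl n (t + 1) * w))).image
          fun l => (t + 1) :: (t + 2) :: l := by
    ext l
    simp only [Finset.mem_filter, Finset.mem_biUnion, Finset.mem_image, mem_wordsOfLength,
      Finset.mem_range]
    constructor
    · rintro ⟨⟨h1, h2⟩, h3⟩
      match l, h1, h2, h3 with
      | a :: b :: l, h1, h2, h3 =>
        obtain ⟨h4, h5⟩ := isWordFor_cons.1 h2
        obtain ⟨h6, h7⟩ := isWordFor_cons.1 h5
        simp only [List.getD_cons_succ, List.getD_cons_zero] at h3
        subst h3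
        rw [Finset.mem_Ico] at h4 h6
        obtain ⟨t, rfl⟩ : ∃ t, a = t + 1 := ⟨a - 1, by omega⟩
        exact ⟨t, by omega, l, ⟨by simpa using h1, h7⟩, rfl⟩
    · rintro ⟨t, ht, l', ⟨h1, h2⟩, rfl⟩
      refine ⟨⟨by simp [h1], ?_⟩, by simp⟩
      exact isWordFor_cons.2 ⟨by rw [Finset.mem_Ico]; omega,
        isWordFor_cons.2 ⟨by rw [Finset.mem_Ico]; omega, h2⟩⟩
  rw [h, Finset.card_biUnion]
  · refine Finset.sum_congr rfl fun t _ => Finset.card_image_of_injective _ fun l l' h => ?_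
    simpa using h
  · intro t _ t' _ hne
    refine Finset.disjoint_left.2 fun l hl hl' => hne ?_
    obtain ⟨a, -, rfl⟩ := Finset.mem_image.1 hl
    obtain ⟨b, -, h⟩ := Finset.mem_image.1 hl'
    simp only [List.cons.injEq] at h
    omega

theorem w₀_mul_self (n : ℕ) : w₀ n * w₀ n = 1 := by
  ext i
  simp [w₀]

theorem w₀_mul_simpleRefl {n i : ℕ} (hi : i ∈ Finset.Ico 1 n) :
    w₀ n * simpleRefl n (n - i) = simpleRefl n i * w₀ n := by
  rw [Finset.mem_Ico] at hi
  rw [simpleRefl, dif_pos (by omega), simpleRefl, dif_pos hi, Equiv.mul_swap_eq_swap_mul,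
    Equiv.swap_comm]
  congr 2 <;> simp only [w₀, Fin.revPerm_apply, Fin.ext_iff, Fin.val_rev] <;> omega

theorem isWordFor_rotate {n i : ℕ} {l : List ℕ} (h : IsWordFor n (w₀ n) (i :: l)) :
    IsWordFor n (w₀ n) (l ++ [n - i]) := by
  obtain ⟨hi, h1, h2⟩ := isWordFor_cons.1 h
  constructor
  · intro j hj
    rw [List.mem_append, List.mem_singleton] at hj
    rw [Finset.mem_Ico] at hi
    rcases hj with hj | rfl
    · exact h1 j hj
    · omega
  · rw [wordProd_append, h2, mul_assoc, wordProd_cons]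
    simp only [wordProd, List.map_nil, List.prod_nil, mul_one]
    rw [w₀_mul_simpleRefl hi, ← mul_assoc, simpleRefl_mul_self, one_mul]

theorem isWordFor_complement {n : ℕ} {l : List ℕ} {w : Equiv.Perm (Fin n)}
    (h : IsWordFor n w l) : IsWordFor n (w₀ n * w * w₀ n) (l.map (n - ·)) := by
  induction l generalizing w with
  | nil =>
    obtain ⟨h1, h2⟩ := h
    have : w = 1 := h2.symm.trans (by simp [wordProd])
    subst this
    refine ⟨by simp, ?_⟩
    rw [mul_one, w₀_mul_self]
    simp [wordProd]
  | cons i l ih =>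
    obtain ⟨hi, h1⟩ := isWordFor_cons.1 h
    rw [List.map_cons, isWordFor_cons]
    have hi' : n - i ∈ Finset.Ico 1 n := by
      rw [Finset.mem_Ico] at hi ⊢
      omega
    refine ⟨hi', ?_⟩
    have e := w₀_mul_simpleRefl hi'
    rw [Finset.mem_Ico] at hi
    rw [show n - (n - i) = i by omega] at e
    have := ih h1
    rwa [← mul_assoc (w₀ n), e, mul_assoc (simpleRefl n (n - i)), mul_assoc] at this

theorem sum_wordsOfLength_w₀_rotate (n N k : ℕ) (hk : k + 2 < N) :
    ((wordsOfLength n N (w₀ n)).filter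
      fun l => |(l.getD (k + 1) 0 : ℤ) - (l.getD (k + 1 + 1) 0 : ℤ)| = 1).card =
    ((wordsOfLength n N (w₀ n)).filter
      fun l => |(l.getD k 0 : ℤ) - (l.getD (k + 1) 0 : ℤ)| = 1).card := by
  set S := wordsOfLength n N (w₀ n) with hS
  let ρ : List ℕ → List ℕ := fun l => l.tail ++ [n - l.getD 0 0]
  have hcons : ∀ l ∈ S, ∃ a l', l = a :: l' ∧ l'.length + 1 = N ∧ IsWordFor n (w₀ n) (a :: l') := by
    intro l hl
    obtain ⟨h1, h2⟩ := mem_wordsOfLength.1 hl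
    match l, h1, h2 with
    | a :: l', h1, h2 => exact ⟨a, l', rfl, by simpa using h1, h2⟩
    | [], h1, h2 => simp at h1; omega
  have hmaps : ∀ l ∈ S, ρ l ∈ S := by
    intro l hl
    obtain ⟨a, l', rfl, h1, h2⟩ := hcons l hl
    exact mem_wordsOfLength.2 ⟨by simpa [ρ] using h1, isWordFor_rotate h2⟩
  have hinj : ∀ l ∈ S, ∀ l' ∈ S, ρ l = ρ l' → l = l' := by
    intro l hl l' hl' h
    obtain ⟨a, t, rfl, -, h2⟩ := hcons l hl
    obtain ⟨a', t', rfl, -, h4⟩ := hcons l' hl'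
    have h5 := (h2.1 a (by simp))
    have h6 := (h4.1 a' (by simp))
    simp only [ρ, List.tail_cons, List.getD_cons_zero] at h
    obtain ⟨h7, h8⟩ := List.append_inj' h rfl
    simp only [List.cons.injEq, and_true] at h8
    rw [h7, show a = a' by omega]
  have himage : S.image ρ = S := by
    refine Finset.eq_of_subset_of_card_le (Finset.image_subset_iff.2 hmaps) ?_
    rw [Finset.card_image_of_injOn hinj]
  have hget : ∀ l ∈ S, ∀ j, j + 1 < N → (ρ l).getD j 0 = l.getD (j + 1) 0 := by
    intro l hl j hj
    obtain ⟨a, t, rfl, h1, -⟩ := hcons l hl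
    simp only [ρ, List.tail_cons, List.getD_cons_succ]
    exact List.getD_append _ _ _ _ (by omega)
  rw [Finset.card_filter, Finset.card_filter]
  conv_rhs => rw [← himage, Finset.sum_image hinj]
  refine Finset.sum_congr rfl fun l hl => ?_
  rw [hget l hl k (by omega), hget l hl (k + 1) (by omega)]

theorem card_filter_complement (n N : ℕ) :
    ((wordsOfLength n (N + 2) (w₀ n)).filter fun l => l.getD 0 0 = l.getD 1 0 + 1).card =
      ((wordsOfLength n (N + 2) (w₀ n)).filter fun l => l.getD 1 0 = l.getD 0 0 + 1).card := by
  have hmem : ∀ l ∈ wordsOfLength n (N + 2) (w₀ n),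
      l.map (n - ·) ∈ wordsOfLength n (N + 2) (w₀ n) := by
    intro l hl
    obtain ⟨h1, h2⟩ := mem_wordsOfLength.1 hl
    refine mem_wordsOfLength.2 ⟨by simpa using h1, ?_⟩
    have := isWordFor_complement h2
    rwa [w₀_mul_self, one_mul] at this
  have hinv : ∀ l ∈ wordsOfLength n (N + 2) (w₀ n), (l.map (n - ·)).map (n - ·) = l := by
    intro l hl
    obtain ⟨-, h2, -⟩ := mem_wordsOfLength.1 hl
    rw [List.map_map]
    conv_rhs => rw [← List.map_id l]
    refine List.map_congr_left fun i hi => ?_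
    have := h2 i hi
    simp only [Function.comp_apply, id]
    omega
  have hget : ∀ l ∈ wordsOfLength n (N + 2) (w₀ n),
      (l.map (n - ·)).getD 0 0 = n - l.getD 0 0 ∧ (l.map (n - ·)).getD 1 0 = n - l.getD 1 0 ∧
        (1 ≤ l.getD 0 0 ∧ l.getD 0 0 ≤ n - 1) ∧ (1 ≤ l.getD 1 0 ∧ l.getD 1 0 ≤ n - 1) := by
    intro l hl
    obtain ⟨h1, h2, -⟩ := mem_wordsOfLength.1 hl
    match l, h1, h2 with
    | a :: b :: l', h1, h2 =>
      exact ⟨rfl, rfl, h2 a (by simp), h2 b (by simp)⟩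
  refine Finset.card_nbij' (List.map (n - ·)) (List.map (n - ·)) ?_ ?_ ?_ ?_
  · intro l hl
    simp only [Finset.coe_filter, Set.mem_ofPred_eq] at hl ⊢
    have := hget l hl.1
    exact ⟨hmem l hl.1, by omega⟩
  · intro l hl
    simp only [Finset.coe_filter, Set.mem_ofPred_eq] at hl ⊢
    have := hget l hl.1
    exact ⟨hmem l hl.1, by omega⟩
  · intro l hl
    exact hinv l (Finset.mem_filter.1 hl).1
  · intro l hl
    exact hinv l (Finset.mem_filter.1 hl).1

theorem sum_noncommCount (n N : ℕ) :
    ∑ l ∈ wordsOfLength n (N + 2) (w₀ n), noncommCount l =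
      (N + 1) * (2 * ∑ t ∈ Finset.range (n - 2),
        (wordsOfLength n N (simpleRefl n (t + 2) * (simpleRefl n (t + 1) * w₀ n))).card) := by
  rw [← card_wordsOfLength_filter_succ]
  set S := wordsOfLength n (N + 2) (w₀ n) with hS
  have h1 : ∀ l ∈ S, noncommCount l = ∑ k ∈ Finset.range (N + 1),
      if |(l.getD k 0 : ℤ) - (l.getD (k + 1) 0 : ℤ)| = 1 then 1 else 0 := by
    intro l hl
    rw [noncommCount, (mem_wordsOfLength.1 hl).1, Finset.card_filter]
    rfl
  have h2 : ∀ k < N + 1, (S.filter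
      fun l => |(l.getD k 0 : ℤ) - (l.getD (k + 1) 0 : ℤ)| = 1).card =
      2 * (S.filter fun l => l.getD 1 0 = l.getD 0 0 + 1).card := by
    intro k
    induction k with
    | zero =>
      intro _
      rw [two_mul]
      nth_rw 2 [← card_filter_complement]
      rw [← Finset.card_union_of_disjoint, ← Finset.filter_or]
      · congr 1
        refine Finset.filter_congr fun l _ => ?_
        rw [zero_add, abs_eq zero_le_one]
        omega
      · exact Finset.disjoint_filter.2 fun l _ h h' => by omega
    | succ k ih =>
      intro hk
      rw [sum_wordsOfLength_w₀_rotate n (N + 2) k (by omega), ih (by omega)]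
  rw [Finset.sum_congr rfl h1, Finset.sum_comm]
  rw [Finset.sum_congr rfl fun k hk => (Finset.card_filter _ _).symm.trans
    (h2 k (Finset.mem_range.1 hk)), Finset.sum_const, Finset.card_range, smul_eq_mul]

theorem expectedStat_noncommCount {n : ℕ} (hn : 3 ≤ n) :
    expectedStat n noncommCount * (n * (n - 1) / 2) =
      32 / 3 * ∑ t ∈ Finset.range (n - 2), ((t + 1 : ℕ) : ℝ) / Real.Wallis.W (t + 1) *
        ((n - 2 - t : ℕ) / Real.Wallis.W (n - 2 - t)) := by
  have hsum : (∑ k : Fin n, (k : ℕ)) * 2 = n * (n - 1) := by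
    rw [Fin.sum_univ_eq_sum_range (fun k => k), Finset.sum_range_id_mul_two]
  obtain ⟨N, hN⟩ : ∃ N, N + 2 = ∑ k : Fin n, (k : ℕ) := by
    have : 3 * 2 ≤ n * (n - 1) := Nat.mul_le_mul hn (by omega)
    exact ⟨(∑ k : Fin n, (k : ℕ)) - 2, by omega⟩
  have hNn : (n * (n - 1) / 2 : ℝ) = N + 2 := by
    rw [← hN] at hsum
    have : ((N + 2 : ℕ) * 2 : ℝ) = n * (n - 1 : ℕ) := by exact_mod_cast hsum
    rw [Nat.cast_sub (by omega)] at this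
    push_cast at this
    linarith
  have hmem := isReducedWordFor_w₀_iff n
  have hpos := card_wordsOfLength_w₀_pos n
  rw [← hN] at hmem hpos
  have hset : {l : List ℕ | IsReducedWordFor n (w₀ n) l} =
      ((wordsOfLength n (N + 2) (w₀ n) : Finset (List ℕ)) : Set (List ℕ)) := by
    ext l
    exact (hmem l).symm
  rw [hNn, expectedStat, hset, finsum_mem_coe_finset, Nat.subtype_card _ hmem, ← Nat.cast_sum,
    sum_noncommCount]
  have hR : ((wordsOfLength n (N + 2) (w₀ n)).card : ℝ) ≠ 0 := by exact_mod_cast hpos.ne'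
  rw [div_mul_eq_mul_div, div_eq_iff hR]
  push_cast
  rw [show ∀ A : ℝ, ((N : ℝ) + 1) * (2 * A) * (N + 2) = 2 * (A * ((N + 2) * (N + 1))) by
    intro A; ring, Finset.sum_mul, Finset.mul_sum, Finset.mul_sum, Finset.sum_mul]
  refine Finset.sum_congr rfl fun t ht => ?_
  rw [Finset.mem_range] at ht
  obtain ⟨M, hM⟩ : ∃ M, n = t + 1 + 2 + M := ⟨n - 3 - t, by omega⟩
  rw [card_wordsOfLength_cycle hM hN, show n - 2 - t = M + 1 by omega]
  push_cast
  ring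

theorem sum_range_add_mul_sub (a c : ℝ) (m : ℕ) :
    ∑ t ∈ Finset.range m, ((t : ℝ) + a) * (c - t) =
      m * a * c + (c - a) * (m * (m - 1) / 2) - m * (m - 1) * (2 * m - 1) / 6 := by
  induction m with
  | zero => simp
  | succ m ih =>
    rw [Finset.sum_range_succ, ih]
    push_cast
    ring

theorem le_div_wallis (k : ℕ) : 2 / Real.pi * k ≤ k / Real.Wallis.W k := by
  have h := Real.Wallis.W_le k
  have hW := Real.Wallis.W_pos k
  have hpi := Real.pi_pos
  rw [div_mul_eq_mul_div, div_le_div_iff₀ hpi hW]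
  nlinarith [Nat.cast_nonneg (α := ℝ) k]

theorem div_wallis_le (k : ℕ) : k / Real.Wallis.W k ≤ 2 / Real.pi * (k + 1) := by
  have h := Real.Wallis.le_W k
  have hW := Real.Wallis.W_pos k
  have hpi := Real.pi_pos
  have hk := Nat.cast_nonneg (α := ℝ) k
  rw [div_mul_eq_mul_div, div_le_div_iff₀ hW hpi]
  rw [div_mul_eq_mul_div, div_le_iff₀ (by positivity)] at h
  nlinarith

theorem le_sum_div_wallis {n : ℕ} (hn : 2 ≤ n) :
    4 / Real.pi ^ 2 * ((n - 2) * (n - 1) * n / 6) ≤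
      ∑ t ∈ Finset.range (n - 2), ((t + 1 : ℕ) : ℝ) / Real.Wallis.W (t + 1) *
        ((n - 2 - t : ℕ) / Real.Wallis.W (n - 2 - t)) := by
  have h := sum_range_add_mul_sub 1 (n - 2) (n - 2)
  rw [Nat.cast_sub hn, Nat.cast_ofNat] at h
  rw [show ((n : ℝ) - 2) * (n - 1) * n / 6 = _ from (by ring : _ = _).trans h.symm,
    Finset.mul_sum]
  refine Finset.sum_le_sum fun t ht => ?_
  rw [Finset.mem_range] at ht
  have h1 := le_div_wallis (t + 1)
  have h2 := le_div_wallis (n - 2 - t)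
  have hpi := Real.pi_pos
  refine le_trans (le_of_eq ?_) (mul_le_mul h1 h2 (by positivity)
    (div_nonneg (by positivity) (Real.Wallis.W_pos _).le))
  rw [Nat.cast_sub ht.le, Nat.cast_sub hn]
  push_cast
  ring

theorem sum_div_wallis_le {n : ℕ} (hn : 2 ≤ n) :
    ∑ t ∈ Finset.range (n - 2), ((t + 1 : ℕ) : ℝ) / Real.Wallis.W (t + 1) *
        ((n - 2 - t : ℕ) / Real.Wallis.W (n - 2 - t)) ≤
      4 / Real.pi ^ 2 * (n * (n + 5) * (n - 2) / 6) := by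
  have h := sum_range_add_mul_sub 2 (n - 1) (n - 2)
  rw [Nat.cast_sub hn, Nat.cast_ofNat] at h
  rw [show (n : ℝ) * (n + 5) * (n - 2) / 6 = _ from (by ring : _ = _).trans h.symm,
    Finset.mul_sum]
  refine Finset.sum_le_sum fun t ht => ?_
  rw [Finset.mem_range] at ht
  have h1 := div_wallis_le (t + 1)
  have h2 := div_wallis_le (n - 2 - t)
  have hpi := Real.pi_pos
  refine le_trans (mul_le_mul h1 h2 (div_nonneg (by positivity) (Real.Wallis.W_pos _).le)
    (by positivity)) (le_of_eq ?_)
  rw [Nat.cast_sub ht.le, Nat.cast_sub hn]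
  push_cast
  ring

theorem mul_expectedStat_noncommCount_div {n : ℕ} (hn : 3 ≤ n) :
    n * expectedStat n noncommCount / (n * (n - 1) / 2) =
      128 / 3 * (∑ t ∈ Finset.range (n - 2), ((t + 1 : ℕ) : ℝ) / Real.Wallis.W (t + 1) *
        ((n - 2 - t : ℕ) / Real.Wallis.W (n - 2 - t))) / (n * (n - 1) ^ 2) := by
  have h := expectedStat_noncommCount hn
  have hn' : (3 : ℝ) ≤ n := by exact_mod_cast hn
  have h1 : (n : ℝ) ≠ 0 := by linarith
  have h2 : (n : ℝ) - 1 ≠ 0 := by linarith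
  rw [div_eq_div_iff (by positivity) (by positivity)]
  linear_combination (4 * n : ℝ) * ((n - 1) / 2) * h

/-- The asymptotic frequency of consecutive noncommuting pairs in a uniformly random
reduced word for `w₀ ∈ S_n` is `256/(9π²n)`. -/
theorem noncommuting_frequency :
    Filter.Tendsto
      (fun n : ℕ => (n : ℝ) * expectedStat n noncommCount / ((n : ℝ) * ((n : ℝ) - 1) / 2))
      Filter.atTop (nhds (256 / (9 * Real.pi ^ 2))) := by
  have hinv : Filter.Tendsto (fun n : ℕ => ((n : ℝ) - 1)⁻¹) Filter.atTop (nhds 0) :=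
    tendsto_inv_atTop_zero.comp
      (Filter.tendsto_atTop_add_const_right _ (-1) tendsto_natCast_atTop_atTop)
  have hlow : Filter.Tendsto (fun n : ℕ => 256 / (9 * Real.pi ^ 2) * (1 - ((n : ℝ) - 1)⁻¹))
      Filter.atTop (nhds (256 / (9 * Real.pi ^ 2))) := by
    simpa using (hinv.const_sub 1).const_mul (256 / (9 * Real.pi ^ 2))
  have hupp : Filter.Tendsto (fun n : ℕ => 256 / (9 * Real.pi ^ 2) * (1 - ((n : ℝ) - 1)⁻¹) *
      (1 + 6 * ((n : ℝ) - 1)⁻¹)) Filter.atTop (nhds (256 / (9 * Real.pi ^ 2))) := by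
    simpa using hlow.mul ((hinv.const_mul 6).const_add 1)
  refine tendsto_of_tendsto_of_tendsto_of_le_of_le' hlow hupp ?_ ?_ <;>
    filter_upwards [Filter.eventually_ge_atTop 3] with n hn
  all_goals
    have hn' : (3 : ℝ) ≤ n := by exact_mod_cast hn
    have h1 : (0 : ℝ) < n := by linarith
    have h2 : (0 : ℝ) < n - 1 := by linarith
    have hpi := Real.pi_pos
    rw [mul_expectedStat_noncommCount_div hn]
  · rw [le_div_iff₀ (by positivity)]
    refine le_trans (le_of_eq ?_)
      (mul_le_mul_of_nonneg_left (le_sum_div_wallis (by omega)) (by norm_num))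
    field_simp
    ring
  · rw [div_le_iff₀ (by positivity)]
    refine le_trans (mul_le_mul_of_nonneg_left (sum_div_wallis_le (by omega)) (by norm_num))
      (le_of_eq ?_)
    field_simp
    ring
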